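/- arXiv:1904.01678 — 2 statements merged into one kernel-verified Lean document; each statement's English description precedes it below -/
import Mathlib

section
/- Let w be a weight on ℝⁿ with [w]^{weak}_{A∞} < ∞ and let f ∈ BMO. Then there exists a dimensional constant C_n, independent of f and w, such that for every cube Q, the exponential Luxemburg norm of f − f_Q with respect to the measure w dx / w(2Q) on Q satisfies ‖f − f_Q‖_{exp L(Q, w dx/w(2Q))} ≤ C_n [w]^{weak}_{A∞} ‖f‖_{BMO}. -/
open MeasureTheory ENNReal Set

noncomputable section

/-- The axis-parallel cube in `ℝⁿ` with lower corner `a` and side length `h`. -/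
def Cube {n : ℕ} (a : Fin n → ℝ) (h : ℝ) : Set (Fin n → ℝ) :=
  Set.univ.pi fun i => Set.Icc (a i) (a i + h)

/-- The concentric double `2Q` of the cube with lower corner `a` and side length `h`. -/
def Cube2 {n : ℕ} (a : Fin n → ℝ) (h : ℝ) : Set (Fin n → ℝ) :=
  Cube (fun i => a i - h / 2) (2 * h)

/-- The average `f_Q` of `f` over the cube with lower corner `a` and side length `h`. -/
def cubeAvg {n : ℕ} (a : Fin n → ℝ) (h : ℝ) (f : (Fin n → ℝ) → ℝ) : ℝ :=
  ⨍ x in Cube a h, f x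

/-- The (uncentered) Hardy–Littlewood maximal function over axis-parallel cubes. -/
def maxFn {n : ℕ} (f : (Fin n → ℝ) → ℝ) (x : Fin n → ℝ) : ℝ≥0∞ :=
  ⨆ (a : Fin n → ℝ) (h : ℝ) (_ : 0 < h) (_ : x ∈ Cube a h),
    (∫⁻ y in Cube a h, ENNReal.ofReal |f y|) / volume (Cube a h)

/-- The BMO seminorm `sup_Q (1/|Q|) ∫_Q |f - f_Q|`, valued in `ℝ≥0∞`. -/
def bmoNorm {n : ℕ} (f : (Fin n → ℝ) → ℝ) : ℝ≥0∞ :=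
  ⨆ (a : Fin n → ℝ) (h : ℝ) (_ : 0 < h),
    (∫⁻ x in Cube a h, ENNReal.ofReal |f x - cubeAvg a h f|) / volume (Cube a h)

/-- The generalized weighted BMO norm `‖f‖_{BMO_{v,Y}} = sup_Q (1/Y(Q)) ∫_Q |f - f_Q| v`. -/
def bmoVY {n : ℕ} (v : (Fin n → ℝ) → ℝ) (Y : (Fin n → ℝ) → ℝ → ℝ≥0∞)
    (f : (Fin n → ℝ) → ℝ) : ℝ≥0∞ :=
  ⨆ (a : Fin n → ℝ) (h : ℝ) (_ : 0 < h),
    (∫⁻ x in Cube a h, ENNReal.ofReal (|f x - cubeAvg a h f| * v x)) / Y a h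

/-- `w(Q) = ∫_Q w` for a cube `Q`. -/
def wInt {n : ℕ} (w : (Fin n → ℝ) → ℝ) (a : Fin n → ℝ) (h : ℝ) : ℝ≥0∞ :=
  ∫⁻ x in Cube a h, ENNReal.ofReal (w x)

/-- `w(2Q) = ∫_{2Q} w` for a cube `Q`. -/
def wInt2 {n : ℕ} (w : (Fin n → ℝ) → ℝ) (a : Fin n → ℝ) (h : ℝ) : ℝ≥0∞ :=
  ∫⁻ x in Cube2 a h, ENNReal.ofReal (w x)

/-- The generalized Fujii–Wilson constant `[v]_{A_{∞,Y}} = sup_Q (1/Y(Q)) ∫_Q M(v χ_Q)`. -/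
def fwY {n : ℕ} (v : (Fin n → ℝ) → ℝ) (Y : (Fin n → ℝ) → ℝ → ℝ≥0∞) : ℝ≥0∞ :=
  ⨆ (a : Fin n → ℝ) (h : ℝ) (_ : 0 < h),
    (∫⁻ x in Cube a h, maxFn ((Cube a h).indicator v) x) / Y a h

/-- The Fujii–Wilson `A∞` constant `[w]_{A∞} = sup_Q (1/w(Q)) ∫_Q M(w χ_Q)`. -/
def fwConst {n : ℕ} (w : (Fin n → ℝ) → ℝ) : ℝ≥0∞ :=
  ⨆ (a : Fin n → ℝ) (h : ℝ) (_ : 0 < h),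
    (∫⁻ x in Cube a h, maxFn ((Cube a h).indicator w) x) / wInt w a h

/-- The weak Fujii–Wilson constant `[w]^{weak}_{A∞} = sup_Q (1/w(2Q)) ∫_Q M(w χ_Q)`. -/
def fwWeak {n : ℕ} (w : (Fin n → ℝ) → ℝ) : ℝ≥0∞ :=
  ⨆ (a : Fin n → ℝ) (h : ℝ) (_ : 0 < h),
    (∫⁻ x in Cube a h, maxFn ((Cube a h).indicator w) x) / wInt2 w a h

/-- The `C_p` normalizing functional `Y(Q) = ∫_{ℝⁿ} M(χ_Q)^p w`. -/
def cpY {n : ℕ} (p : ℝ) (w : (Fin n → ℝ) → ℝ) (a : Fin n → ℝ) (h : ℝ) : ℝ≥0∞ :=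
  ∫⁻ x, (maxFn ((Cube a h).indicator fun _ => (1 : ℝ)) x) ^ p * ENNReal.ofReal (w x)

/-- The `C_p` Fujii–Wilson-type constant `[w]_{C_p}`. -/
def cpConst {n : ℕ} (p : ℝ) (w : (Fin n → ℝ) → ℝ) : ℝ≥0∞ :=
  ⨆ (a : Fin n → ℝ) (h : ℝ) (_ : 0 < h),
    (∫⁻ x in Cube a h, maxFn ((Cube a h).indicator w) x) / cpY p w a h

/-- The `A_p` constant `[w]_{A_p}` for `1 < p < ∞`. -/
def apConst {n : ℕ} (p : ℝ) (w : (Fin n → ℝ) → ℝ) : ℝ≥0∞ :=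
  ⨆ (a : Fin n → ℝ) (h : ℝ) (_ : 0 < h),
    (wInt w a h / volume (Cube a h)) *
      ((∫⁻ x in Cube a h, ENNReal.ofReal (w x) ^ (1 - p / (p - 1))) / volume (Cube a h)) ^ (p - 1)

/-- A weight: a nonnegative locally integrable function on `ℝⁿ`. -/
def IsWeight {n : ℕ} (v : (Fin n → ℝ) → ℝ) : Prop :=
  (∀ x, 0 ≤ v x) ∧ LocallyIntegrable v volume

/-- A cube functional `Y : 𝒬 → (0,∞)`: positive finite values on cubes. -/
def IsCubeFunctional {n : ℕ} (Y : (Fin n → ℝ) → ℝ → ℝ≥0∞) : Prop :=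
  ∀ (a : Fin n → ℝ) (h : ℝ), 0 < h → 0 < Y a h ∧ Y a h < ⊤

/-- Membership in the class `𝒴_q` with constant `β`: for every cube `Q`, every `L ≥ 1`
and every `L`-small family of pairwise non-overlapping subcubes of `Q`,
`∑_{P ∈ Λ} Y(P) ≤ β Y(Q) L^{-1/q}`. -/
def MemY {n : ℕ} (q β : ℝ) (Y : (Fin n → ℝ) → ℝ → ℝ≥0∞) : Prop :=
  ∀ (a : Fin n → ℝ) (h : ℝ), 0 < h → ∀ L : ℝ, 1 ≤ L →
    ∀ Λ : Set ((Fin n → ℝ) × ℝ),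
      (∀ p ∈ Λ, 0 < p.2 ∧ Cube p.1 p.2 ⊆ Cube a h) →
      (Λ.Pairwise fun p r => Disjoint (interior (Cube p.1 p.2)) (interior (Cube r.1 r.2))) →
      (∑' p : Λ, volume (Cube p.1.1 p.1.2)) ≤ volume (Cube a h) / ENNReal.ofReal L →
      (∑' p : Λ, Y p.1.1 p.1.2) ≤ ENNReal.ofReal β * Y a h * ENNReal.ofReal (L ^ (-1 / q))

/-- The Luxemburg norm in the Orlicz space `exp L^β` with respect to the measure `μ`. -/
def expLuxNorm {X : Type*} [MeasurableSpace X] (μ : Measure X) (β : ℝ) (g : X → ℝ) : ℝ≥0∞ :=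
  ⨅ (lam : ℝ) (_ : 0 < lam)
    (_ : ∫⁻ x, ENNReal.ofReal (Real.exp ((|g x| / lam) ^ β) - 1) ∂μ ≤ 1), ENNReal.ofReal lam

/-- The weighted measure `w dx` restricted to a set `Q`. -/
def wMeasureOn {n : ℕ} (w : (Fin n → ℝ) → ℝ) (Q : Set (Fin n → ℝ)) : Measure (Fin n → ℝ) :=
  (volume.restrict Q).withDensity fun x => ENNReal.ofReal (w x)

/-- The dyadic grid `𝒟(Q)` relative to the cube with lower corner `a₀` and side `h₀`:
parameters of all dyadic subcubes of `Q`. -/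
def dyadicOf {n : ℕ} (a₀ : Fin n → ℝ) (h₀ : ℝ) : Set ((Fin n → ℝ) × ℝ) :=
  {p | ∃ (k : ℕ) (m : Fin n → ℕ), (∀ i, m i < 2 ^ k) ∧
    p.2 = h₀ / 2 ^ k ∧ p.1 = fun i => a₀ i + (m i : ℝ) * (h₀ / 2 ^ k)}

/-- The functional `w_r(Q) = |Q| ((1/|Q|) ∫_Q w^r)^{1/r}`. -/
def wrY {n : ℕ} (w : (Fin n → ℝ) → ℝ) (r : ℝ) (a : Fin n → ℝ) (h : ℝ) : ℝ≥0∞ :=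
  volume (Cube a h) *
    ((∫⁻ x in Cube a h, ENNReal.ofReal (w x) ^ r) / volume (Cube a h)) ^ (1 / r)

open Metric

section Balls

variable {n : ℕ}

theorem Cube_eq_closedBall (a : Fin n → ℝ) {h : ℝ} (hh : 0 ≤ h) :
    Cube a h = closedBall (fun i => a i + h / 2) (h / 2) := by
  rw [closedBall_pi _ (by positivity), Cube]
  congr 1
  ext1 i
  rw [Real.closedBall_eq_Icc]
  congr 1 <;> ring

theorem Cube2_eq_closedBall (a : Fin n → ℝ) {h : ℝ} (hh : 0 ≤ h) :
    Cube2 a h = closedBall (fun i => a i + h / 2) (2 * (h / 2)) := by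
  rw [Cube2, Cube_eq_closedBall _ (by positivity)]
  congr 1
  · ext1 i
    ring
  · ring

theorem closedBall_eq_Cube (c : Fin n → ℝ) {r : ℝ} (hr : 0 ≤ r) :
    closedBall c r = Cube (fun i => c i - r) (2 * r) := by
  rw [Cube_eq_closedBall _ (by positivity)]
  congr 1
  · ext1 i
    ring
  · ring

theorem volume_closedBall_pi (c : Fin n → ℝ) {r : ℝ} (hr : 0 ≤ r) :
    volume (closedBall c r) = ENNReal.ofReal ((2 * r) ^ n) := by
  rw [Real.volume_pi_closedBall c hr, Fintype.card_fin]

theorem volume_closedBall_mul (c c' : Fin n → ℝ) {t r : ℝ} (ht : 0 ≤ t) (hr : 0 ≤ r) :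
    volume (closedBall c (t * r)) = ENNReal.ofReal (t ^ n) * volume (closedBall c' r) := by
  rw [volume_closedBall_pi c (by positivity), volume_closedBall_pi c' hr,
    ← ENNReal.ofReal_mul (by positivity)]
  congr 1
  rw [← mul_pow]
  ring

theorem volume_closedBall_ne_zero (c : Fin n → ℝ) {r : ℝ} (hr : 0 < r) :
    volume (closedBall c r) ≠ 0 :=
  (measure_closedBall_pos volume c hr).ne'

theorem volume_closedBall_ne_top (c : Fin n → ℝ) (r : ℝ) : volume (closedBall c r) ≠ ⊤ :=
  measure_closedBall_lt_top.ne

/-- The uncentered Hardy–Littlewood maximal function over closed sup-norm balls. -/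
def ballMax (v : (Fin n → ℝ) → ℝ≥0∞) (x : Fin n → ℝ) : ℝ≥0∞ :=
  ⨆ (c : Fin n → ℝ) (r : ℝ) (_ : 0 < r) (_ : x ∈ closedBall c r),
    (∫⁻ y in closedBall c r, v y) / volume (closedBall c r)

theorem maxFn_eq_ballMax (f : (Fin n → ℝ) → ℝ) (x : Fin n → ℝ) :
    maxFn f x = ballMax (fun y => ENNReal.ofReal |f y|) x := by
  apply le_antisymm
  · refine iSup_le fun a => iSup_le fun h => iSup_le fun hh => iSup_le fun hx => ?_
    rw [Cube_eq_closedBall a hh.le] at hx ⊢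
    exact le_iSup_of_le _ (le_iSup_of_le _ (le_iSup_of_le (half_pos hh)
      (le_iSup_of_le hx le_rfl)))
  · refine iSup_le fun c => iSup_le fun r => iSup_le fun hr => iSup_le fun hx => ?_
    rw [closedBall_eq_Cube c hr.le] at hx ⊢
    exact le_iSup_of_le _ (le_iSup_of_le _ (le_iSup_of_le (by positivity)
      (le_iSup_of_le hx le_rfl)))

theorem le_ballMax_mul (v : (Fin n → ℝ) → ℝ≥0∞) {x c : Fin n → ℝ} {r : ℝ} (hr : 0 < r)
    (hx : x ∈ closedBall c r) :
    ∫⁻ y in closedBall c r, v y ≤ ballMax v x * volume (closedBall c r) := by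
  rw [← ENNReal.div_le_iff (volume_closedBall_ne_zero c hr) (volume_closedBall_ne_top c r)]
  exact le_iSup_of_le c (le_iSup_of_le r (le_iSup_of_le hr (le_iSup_of_le hx le_rfl)))

theorem ballMax_le {v : (Fin n → ℝ) → ℝ≥0∞} {x : Fin n → ℝ} {b : ℝ≥0∞}
    (hb : ∀ c r, 0 < r → x ∈ closedBall c r →
      ∫⁻ y in closedBall c r, v y ≤ b * volume (closedBall c r)) :
    ballMax v x ≤ b := by
  refine iSup_le fun c => iSup_le fun r => iSup_le fun hr => iSup_le fun hx => ?_
  rw [ENNReal.div_le_iff (volume_closedBall_ne_zero c hr) (volume_closedBall_ne_top c r)]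
  exact hb c r hr hx

theorem lt_ballMax_iff {v : (Fin n → ℝ) → ℝ≥0∞} {x : Fin n → ℝ} {b : ℝ≥0∞} :
    b < ballMax v x ↔ ∃ c r, 0 < r ∧ x ∈ closedBall c r ∧
      b * volume (closedBall c r) < ∫⁻ y in closedBall c r, v y := by
  constructor
  · intro hb
    by_contra! hcon
    exact absurd (ballMax_le hcon) (not_le.2 hb)
  · rintro ⟨c, r, hr, hx, hlt⟩
    by_contra! hcon
    refine absurd (le_ballMax_mul v hr hx) (not_le.2 (lt_of_le_of_lt ?_ hlt))
    gcongr

theorem isOpen_lt_ballMax (v : (Fin n → ℝ) → ℝ≥0∞) (b : ℝ≥0∞) :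
    IsOpen {x | b < ballMax v x} := by
  rw [Metric.isOpen_iff]
  intro x hx
  obtain ⟨c, r, hr, hxc, hlt⟩ := lt_ballMax_iff.1 hx
  have hb : b ≠ ⊤ := hx.ne_top
  have hcont : Continuous fun d : ℝ => b * ENNReal.ofReal ((2 * (r + d)) ^ n) :=
    (ENNReal.continuous_const_mul hb).comp (ENNReal.continuous_ofReal.comp (by fun_prop))
  have hev : ∀ᶠ d in nhdsWithin (0 : ℝ) (Ioi 0),
      b * ENNReal.ofReal ((2 * (r + d)) ^ n) < ∫⁻ y in closedBall c r, v y := by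
    refine (hcont.tendsto 0).mono_left nhdsWithin_le_nhds |>.eventually_lt_const ?_
    rwa [add_zero, ← volume_closedBall_pi c hr.le]
  obtain ⟨d, hd, hd0⟩ := (hev.and self_mem_nhdsWithin).exists
  have hd0 : 0 < d := hd0
  refine ⟨d, hd0, fun y hy => lt_ballMax_iff.2 ⟨c, r + d, by positivity, ?_, ?_⟩⟩
  · rw [mem_closedBall] at hxc ⊢
    rw [mem_ball] at hy
    linarith [dist_triangle y x c]
  · rw [volume_closedBall_pi c (by positivity)]
    exact hd.trans_le (lintegral_mono_set (closedBall_subset_closedBall (by linarith)))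

theorem ae_le_ballMax {v : (Fin n → ℝ) → ℝ≥0∞} (hv : AEMeasurable v volume)
    (hv' : ∫⁻ y, v y ≠ ⊤) : ∀ᵐ x, v x ≤ ballMax v x := by
  filter_upwards [(Besicovitch.vitaliFamily (volume : Measure (Fin n → ℝ))).ae_tendsto_lintegral_div
    hv hv'] with x hx
  refine le_of_tendsto (hx.comp (Besicovitch.tendsto_filterAt volume x)) ?_
  filter_upwards [self_mem_nhdsWithin] with r hr
  exact le_iSup_of_le x (le_iSup_of_le r (le_iSup_of_le hr
    (le_iSup_of_le (mem_closedBall_self (le_of_lt hr)) le_rfl)))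

/-- Vitali selection of almost maximal balls on a superlevel set of the maximal function. -/
theorem exists_disjoint_almost_maximal_balls (v : (Fin n → ℝ) → ℝ≥0∞) (b : ℝ≥0∞)
    (R : ℝ) (hR : ∀ c r, 0 < r → b * volume (closedBall c r) < ∫⁻ y in closedBall c r, v y → r ≤ R)
    (S : Set (Fin n → ℝ)) (hS : ∀ x ∈ S, b < ballMax v x) :
    ∃ (T : Set (Fin n → ℝ)) (c : (Fin n → ℝ) → (Fin n → ℝ)) (r : (Fin n → ℝ) → ℝ),
      T ⊆ S ∧ T.Countable ∧ (T.PairwiseDisjoint fun x => closedBall (c x) (r x)) ∧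
      S ⊆ ⋃ x ∈ T, closedBall (c x) (5 * r x) ∧
      ∀ x ∈ T, 0 < r x ∧ r x ≤ R ∧ x ∈ closedBall (c x) (r x) ∧
        b * volume (closedBall (c x) (r x)) < ∫⁻ y in closedBall (c x) (r x), v y ∧
        ∀ c' r', 2 * r x ≤ r' → x ∈ closedBall c' r' →
          ∫⁻ y in closedBall c' r', v y ≤ b * volume (closedBall c' r') := by
  have hsel : ∀ x, x ∈ S → ∃ (c : Fin n → ℝ) (r : ℝ), 0 < r ∧ r ≤ R ∧ x ∈ closedBall c r ∧
        b * volume (closedBall c r) < ∫⁻ y in closedBall c r, v y ∧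
        ∀ c' r', 2 * r ≤ r' → x ∈ closedBall c' r' →
          ∫⁻ y in closedBall c' r', v y ≤ b * volume (closedBall c' r') := by
    intro x hx
    let A : Set ℝ := {r | 0 < r ∧ ∃ c, x ∈ closedBall c r ∧
      b * volume (closedBall c r) < ∫⁻ y in closedBall c r, v y}
    have hbdd : BddAbove A := ⟨R, fun r ⟨hr, c, _, h⟩ => hR c r hr h⟩
    obtain ⟨c₀, r₀, hr₀, hx₀, h₀⟩ := lt_ballMax_iff.1 (hS x hx)
    have hA₀ : r₀ ∈ A := ⟨hr₀, c₀, hx₀, h₀⟩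
    have hpos : 0 < sSup A := hr₀.trans_le (le_csSup hbdd hA₀)
    obtain ⟨r, ⟨hr, c, hxc, hlt⟩, hsup⟩ := exists_lt_of_lt_csSup ⟨r₀, hA₀⟩ (half_lt_self hpos)
    refine ⟨c, r, hr, hR c r hr hlt, hxc, hlt, fun c' r' hr' hx' => ?_⟩
    by_contra! hcon
    have : r' ≤ sSup A := le_csSup hbdd ⟨by linarith, c', hx', hcon⟩
    linarith
  choose! c r h0 hrR hxc hlt hmax using hsel
  obtain ⟨T, hTS, hTd, hTc⟩ := Vitali.exists_disjoint_subfamily_covering_enlargement_closedBall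
    S c r R hrR 5 (by norm_num)
  refine ⟨T, c, r, hTS, ?_, hTd, ?_, fun x hx => ⟨h0 x (hTS hx), hrR x (hTS hx), hxc x (hTS hx),
    hlt x (hTS hx), hmax x (hTS hx)⟩⟩
  · refine hTd.countable_of_nonempty_interior fun x hx => ?_
    exact ⟨c x, mem_interior_iff_mem_nhds.2 (closedBall_mem_nhds _ (h0 x (hTS hx)))⟩
  · intro x hx
    obtain ⟨y, hy, hsub⟩ := hTc x hx
    exact mem_biUnion hy (hsub (hxc x hx))

theorem tsum_volume_closedBall_le {T : Set (Fin n → ℝ)} (hT : T.Countable)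
    {c : (Fin n → ℝ) → (Fin n → ℝ)} {r : (Fin n → ℝ) → ℝ}
    (hd : T.PairwiseDisjoint fun x => closedBall (c x) (r x)) {A : Set (Fin n → ℝ)}
    (hA : ∀ x ∈ T, closedBall (c x) (r x) ⊆ A) :
    ∑' x : T, volume (closedBall (c x) (r x)) ≤ volume A := by
  rw [← measure_biUnion hT hd fun _ _ => isClosed_closedBall.measurableSet]
  exact measure_mono (iUnion₂_subset hA)

end Balls

section Superlevel

variable {n : ℕ}

theorem setLIntegral_le_of_ball_cover {T S A : Set (Fin n → ℝ)} (hT : T.Countable)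
    {c : (Fin n → ℝ) → (Fin n → ℝ)} {r : (Fin n → ℝ) → ℝ}
    (hd : T.PairwiseDisjoint fun x => closedBall (c x) (r x))
    (hA : ∀ x ∈ T, closedBall (c x) (r x) ⊆ A)
    (hS : S ⊆ ⋃ x ∈ T, closedBall (c x) (5 * r x)) {F : (Fin n → ℝ) → ℝ≥0∞} {κ : ℝ≥0∞}
    (hF : ∀ x ∈ T, ∫⁻ y in closedBall (c x) (5 * r x), F y ≤ κ * volume (closedBall (c x) (r x))) :
    ∫⁻ y in S, F y ≤ κ * volume A := by
  have : Countable T := hT.to_subtype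
  calc ∫⁻ y in S, F y ≤ ∫⁻ y in ⋃ x : T, closedBall (c x) (5 * r x), F y := by
        rw [iUnion_coe_set]
        exact lintegral_mono_set hS
    _ ≤ ∑' x : T, ∫⁻ y in closedBall (c x) (5 * r x), F y := lintegral_iUnion_le _ _
    _ ≤ ∑' x : T, κ * volume (closedBall (c x) (r x)) :=
        ENNReal.tsum_le_tsum fun x => hF x x.2
    _ = κ * ∑' x : T, volume (closedBall (c x) (r x)) := ENNReal.tsum_mul_left
    _ ≤ κ * volume A := by
        gcongr
        exact tsum_volume_closedBall_le hT hd hA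

theorem lintegral_ballMax_superlevel_le {W : (Fin n → ℝ) → ℝ≥0∞} {K b : ℝ≥0∞}
    (hK : ∀ c r, 0 < r → ∫⁻ y in closedBall c r, ballMax ((closedBall c r).indicator W) y
      ≤ K * ∫⁻ y in closedBall c (2 * r), W y)
    {c₀ : Fin n → ℝ} {ρ s t R : ℝ} {u : (Fin n → ℝ) → ℝ≥0∞}
    (hu : u = (closedBall c₀ ρ).indicator W)
    (hR : ∀ c r, 0 < r → b * volume (closedBall c r) < ∫⁻ y in closedBall c r, u y → r ≤ R)
    (hst : s + 2 * R ≤ t) (hsρ : s + 31 * R ≤ ρ) :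
    ∫⁻ y in closedBall c₀ s ∩ {x | b < ballMax u x}, ballMax u y
      ≤ (ENNReal.ofReal (30 ^ n) * K + ENNReal.ofReal (15 ^ n)) *
        (b * volume (closedBall c₀ t ∩ {x | b < ballMax u x})) ∧
    ∫⁻ y in closedBall c₀ s ∩ {x | b < ballMax u x}, u y
      ≤ ENNReal.ofReal (5 ^ n) * (b * volume (closedBall c₀ t ∩ {x | b < ballMax u x})) := by
  obtain ⟨T, c, r, hTS, hT, hd, hcov, hsel⟩ := exists_disjoint_almost_maximal_balls u b R hR
    (closedBall c₀ s ∩ {x | b < ballMax u x}) fun x hx => hx.2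
  have hA : ∀ x ∈ T, closedBall (c x) (r x) ⊆ closedBall c₀ t ∩ {x | b < ballMax u x} := by
    intro x hx y hy
    obtain ⟨h0, hrR, hxc, hlt, -⟩ := hsel x hx
    refine ⟨?_, lt_ballMax_iff.2 ⟨c x, r x, h0, hy, hlt⟩⟩
    have hxs := (hTS hx).1
    rw [mem_closedBall] at *
    linarith [dist_triangle y x c₀, dist_triangle_right y x (c x)]
  have hscale : ∀ x ∈ T, ∀ k : ℝ, 2 ≤ k →
      ∫⁻ y in closedBall (c x) (k * r x), u y
        ≤ ENNReal.ofReal (k ^ n) * (b * volume (closedBall (c x) (r x))) := by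
    intro x hx k hk
    obtain ⟨h0, hrR, hxc, hlt, hmax⟩ := hsel x hx
    refine (hmax (c x) (k * r x) (by gcongr) ?_).trans ?_
    · exact closedBall_subset_closedBall (by nlinarith) hxc
    · rw [volume_closedBall_mul (c x) (c x) (by positivity) h0.le]
      exact (mul_left_comm _ _ _).le
  constructor
  · rw [← mul_assoc]
    refine setLIntegral_le_of_ball_cover hT hd hA hcov fun x hx => ?_
    obtain ⟨h0, hrR, hxc, hlt, hmax⟩ := hsel x hx
    set V : (Fin n → ℝ) → ℝ≥0∞ := (closedBall (c x) (15 * r x)).indicator W with hV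
    have hpt : ∀ y ∈ closedBall (c x) (5 * r x),
        ballMax u y ≤ ballMax V y + ENNReal.ofReal (3 ^ n) * b := by
      intro y hy
      refine ballMax_le fun c' r' hr' hyc' => ?_
      rw [mem_closedBall] at hy hxc hyc'
      rcases le_or_gt r' (5 * r x) with hle | hgt
      · have hsub : closedBall c' r' ⊆ closedBall (c x) (15 * r x) := by
          intro z hz
          rw [mem_closedBall] at *
          linarith [dist_triangle z y (c x), dist_triangle_right z y c']
        calc ∫⁻ z in closedBall c' r', u z ≤ ∫⁻ z in closedBall c' r', V z := by
              refine setLIntegral_mono' isClosed_closedBall.measurableSet fun z hz => ?_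
              rw [hV, indicator_of_mem (hsub hz), hu]
              exact indicator_le_self _ _ _
          _ ≤ ballMax V y * volume (closedBall c' r') :=
              le_ballMax_mul V hr' (mem_closedBall.2 hyc')
          _ ≤ _ := by gcongr; exact le_self_add
      · have hx' : x ∈ closedBall c' (3 * r') := by
          rw [mem_closedBall]
          linarith [dist_triangle x y c', dist_triangle_right x y (c x)]
        calc ∫⁻ z in closedBall c' r', u z ≤ ∫⁻ z in closedBall c' (3 * r'), u z :=
              lintegral_mono_set (closedBall_subset_closedBall (by linarith))
          _ ≤ b * volume (closedBall c' (3 * r')) := hmax c' _ (by linarith) hx'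
          _ = ENNReal.ofReal (3 ^ n) * b * volume (closedBall c' r') := by
              rw [volume_closedBall_mul c' c' (by norm_num) hr'.le]
              ring
          _ ≤ _ := by gcongr; exact le_add_self
    have hWu : ∫⁻ y in closedBall (c x) (30 * r x), W y
        ≤ ∫⁻ y in closedBall (c x) (30 * r x), u y := by
      refine setLIntegral_mono' isClosed_closedBall.measurableSet fun z hz => ?_
      rw [hu, indicator_of_mem]
      have hxs := (hTS hx).1
      rw [mem_closedBall] at *
      linarith [dist_triangle z (c x) c₀, dist_triangle_left (c x) c₀ x]
    calc ∫⁻ y in closedBall (c x) (5 * r x), ballMax u y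
        ≤ ∫⁻ y in closedBall (c x) (5 * r x), (ballMax V y + ENNReal.ofReal (3 ^ n) * b) :=
          setLIntegral_mono' isClosed_closedBall.measurableSet hpt
      _ = (∫⁻ y in closedBall (c x) (5 * r x), ballMax V y) +
            ENNReal.ofReal (3 ^ n) * b * volume (closedBall (c x) (5 * r x)) := by
          rw [lintegral_add_right _ measurable_const, setLIntegral_const]
      _ ≤ (∫⁻ y in closedBall (c x) (15 * r x), ballMax V y) +
            ENNReal.ofReal (3 ^ n) * b * volume (closedBall (c x) (5 * r x)) := by
          gcongr
          norm_num
      _ ≤ K * (∫⁻ y in closedBall (c x) (30 * r x), W y) +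
            ENNReal.ofReal (3 ^ n) * b * volume (closedBall (c x) (5 * r x)) := by
          gcongr
          refine (hK (c x) (15 * r x) (by positivity)).trans_eq ?_
          rw [← mul_assoc]
          norm_num
      _ ≤ K * (ENNReal.ofReal (30 ^ n) * (b * volume (closedBall (c x) (r x)))) +
            ENNReal.ofReal (3 ^ n) * b *
              (ENNReal.ofReal (5 ^ n) * volume (closedBall (c x) (r x))) := by
          rw [volume_closedBall_mul (c x) (c x) (by norm_num) h0.le]
          gcongr
          exact hWu.trans (hscale x hx 30 (by norm_num))
      _ = _ := by
          have : ENNReal.ofReal (15 ^ n) = ENNReal.ofReal (3 ^ n) * ENNReal.ofReal (5 ^ n) := by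
            rw [← ENNReal.ofReal_mul (by positivity), ← mul_pow]
            norm_num
          rw [this]
          ring
  · rw [← mul_assoc]
    refine setLIntegral_le_of_ball_cover hT hd hA hcov fun x hx => ?_
    rw [mul_assoc]
    exact hscale x hx 5 (by norm_num)

end Superlevel

section Levels

theorem sum_range_ite_lt_le {l : ℕ → ℝ≥0∞} (hl : ∀ i, 2 * l i ≤ l (i + 1)) (m : ℝ≥0∞) (N : ℕ) :
    ∑ i ∈ Finset.range N, (if l i < m then l i else 0) ≤ 2 * m := by
  have hsum : ∀ N, ∑ i ∈ Finset.range N, l i ≤ l N := by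
    intro N
    induction N with
    | zero => simp
    | succ N ih =>
      rw [Finset.sum_range_succ]
      calc _ ≤ l N + l N := by gcongr
        _ = 2 * l N := (two_mul _).symm
        _ ≤ _ := hl N
  induction N with
  | zero => simp
  | succ N ih =>
    rw [Finset.sum_range_succ]
    by_cases hN : l N < m
    · rw [if_pos hN, two_mul]
      refine add_le_add (le_trans (Finset.sum_le_sum fun i _ => ?_) ((hsum N).trans hN.le)) hN.le
      split_ifs
      · exact le_rfl
      · exact zero_le
    · rwa [if_neg hN, add_zero]

theorem one_add_pow_eq_one_add_sum (η : ℝ) (N : ℕ) :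
    (1 + η) ^ N = 1 + ∑ i ∈ Finset.range N, η * (1 + η) ^ i := by
  induction N with
  | zero => simp
  | succ N ih =>
    rw [Finset.sum_range_succ, ← add_assoc, ← ih]
    ring

theorem sum_geometric_mul_le {b : ℕ → ℝ} (hb : ∀ i, 0 ≤ b i) {η κ : ℝ} (hη : 0 ≤ η) (hη1 : η ≤ 1)
    (hκ : η * κ ≤ 1 / 2) (htail : ∀ k N, ∑ i ∈ Finset.Ico (k + 1) N, b i ≤ κ * b k) (N : ℕ) :
    ∑ i ∈ Finset.range N, η * (1 + η) ^ i * b i ≤ 3 * b 0 := by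
  have habel : ∀ N, ∑ i ∈ Finset.range N, (1 + η) ^ i * b i = ∑ i ∈ Finset.range N, b i +
      ∑ i ∈ Finset.range N, η * (1 + η) ^ i * ∑ j ∈ Finset.Ico (i + 1) N, b j := by
    intro N
    induction N with
    | zero => simp
    | succ N ih =>
      have hstep : ∑ i ∈ Finset.range N, η * (1 + η) ^ i * ∑ j ∈ Finset.Ico (i + 1) (N + 1), b j
          = ∑ i ∈ Finset.range N, η * (1 + η) ^ i * ∑ j ∈ Finset.Ico (i + 1) N, b j
            + (∑ i ∈ Finset.range N, η * (1 + η) ^ i) * b N := by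
        rw [Finset.sum_mul, ← Finset.sum_add_distrib]
        refine Finset.sum_congr rfl fun i hi => ?_
        rw [Finset.sum_Ico_succ_top (Finset.mem_range.1 hi), mul_add]
      rw [Finset.sum_range_succ, ih, Finset.sum_range_succ b, Finset.sum_range_succ
        (fun i => η * (1 + η) ^ i * ∑ j ∈ Finset.Ico (i + 1) (N + 1), b j), hstep,
        Finset.Ico_self, Finset.sum_empty, one_add_pow_eq_one_add_sum η N]
      ring
  set X := ∑ i ∈ Finset.range N, (1 + η) ^ i * b i with hX
  have hX0 : 0 ≤ X := Finset.sum_nonneg fun i _ => mul_nonneg (by positivity) (hb i)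
  have h1 : ∑ i ∈ Finset.range N, b i ≤ b 0 + κ * b 0 := by
    rcases N with _ | N
    · have := htail 0 0
      simp only [zero_add, Finset.Ico_eq_empty_of_le zero_le_one, Finset.sum_empty] at this
      simpa using add_nonneg (hb 0) this
    · rw [Finset.range_eq_Ico, Finset.sum_eq_sum_Ico_succ_bot (Nat.succ_pos N)]
      gcongr
      exact htail 0 _
  have h2 : ∑ i ∈ Finset.range N, η * (1 + η) ^ i * ∑ j ∈ Finset.Ico (i + 1) N, b j
      ≤ 1 / 2 * X := by
    calc _ ≤ ∑ i ∈ Finset.range N, η * (1 + η) ^ i * (κ * b i) :=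
          Finset.sum_le_sum fun i _ => mul_le_mul_of_nonneg_left (htail i N) (by positivity)
      _ = η * κ * X := by
          rw [hX, Finset.mul_sum]
          exact Finset.sum_congr rfl fun i _ => by ring
      _ ≤ _ := by gcongr
  have h3 : X ≤ 2 * (b 0 + κ * b 0) := by linarith [habel N]
  calc ∑ i ∈ Finset.range N, η * (1 + η) ^ i * b i = η * X := by
        rw [hX, Finset.mul_sum]
        exact Finset.sum_congr rfl fun i _ => by ring
    _ ≤ η * (2 * (b 0 + κ * b 0)) := by gcongr
    _ = 2 * η * b 0 + 2 * (η * κ) * b 0 := by ring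
    _ ≤ 2 * 1 * b 0 + 2 * (1 / 2) * b 0 := by
        have := hb 0
        gcongr
    _ = 3 * b 0 := by ring

variable {n : ℕ}

theorem exists_levels (hn : n ≠ 0) {W : (Fin n → ℝ) → ℝ≥0∞} {K : ℝ≥0∞}
    (hK : ∀ c r, 0 < r → ∫⁻ y in closedBall c r, ballMax ((closedBall c r).indicator W) y
      ≤ K * ∫⁻ y in closedBall c (2 * r), W y)
    {c₀ : Fin n → ℝ} {ρ : ℝ} (hρ : 0 < ρ) {u : (Fin n → ℝ) → ℝ≥0∞}
    (hu : u = (closedBall c₀ (2 * ρ)).indicator W)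
    (hI : ∫⁻ y in closedBall c₀ (2 * ρ), W y ≠ ⊤) :
    ∃ l b : ℕ → ℝ≥0∞,
      l 0 = (∫⁻ y in closedBall c₀ (2 * ρ), W y) / ENNReal.ofReal ((ρ / 32) ^ n) ∧
      (∀ k, l k = ENNReal.ofReal ((2 ^ n) ^ k) * l 0) ∧
      (∀ k, b k ≠ ⊤) ∧
      b 0 ≤ ENNReal.ofReal (128 ^ n) * ∫⁻ y in closedBall c₀ (2 * ρ), W y ∧
      (∀ k N, ∑ i ∈ Finset.Ico (k + 1) N, b i
        ≤ 2 * (ENNReal.ofReal (30 ^ n) * K + ENNReal.ofReal (15 ^ n)) * b k) ∧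
      ∀ k, ∫⁻ y in closedBall c₀ ρ ∩ {x | l k < ballMax u x}, W y
        ≤ ENNReal.ofReal (5 ^ n) * b k := by
  set I := ∫⁻ y in closedBall c₀ (2 * ρ), W y with hIdef
  set R : ℕ → ℝ := fun k => ρ / 64 / 2 ^ k with hRdef
  have hR0 : ∀ k, 0 < R k := fun k => by positivity
  have hRs : ∀ k, R (k + 1) = R k / 2 := fun k => by simp only [hRdef]; ring
  have hRle : ∀ k, R k ≤ ρ / 64 := fun k =>
    div_le_self (by positivity) (one_le_pow₀ (by norm_num))
  set l : ℕ → ℝ≥0∞ := fun k => I / ENNReal.ofReal ((2 * R k) ^ n) with hl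
  have hpos : ∀ k, 0 < (2 * R k) ^ n := fun k => by have := hR0 k; positivity
  have hlk : ∀ k, l k * ENNReal.ofReal ((2 * R k) ^ n) = I := fun k =>
    ENNReal.div_mul_cancel (ENNReal.ofReal_pos.2 (hpos k)).ne' ENNReal.ofReal_ne_top
  have hltop : ∀ k, l k ≠ ⊤ := fun k =>
    ENNReal.div_ne_top hI (ENNReal.ofReal_pos.2 (hpos k)).ne'
  have hlpow : ∀ k, l k = ENNReal.ofReal ((2 ^ n) ^ k) * l 0 := by
    intro k
    simp only [hl]
    rw [ENNReal.div_eq_inv_mul, ENNReal.div_eq_inv_mul, ← mul_assoc,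
      ← ENNReal.ofReal_inv_of_pos (hpos k), ← ENNReal.ofReal_inv_of_pos (hpos 0),
      ← ENNReal.ofReal_mul (by positivity)]
    congr 2
    simp only [hRdef]
    rw [← pow_mul, mul_comm n k, pow_mul, ← inv_pow, ← inv_pow, ← mul_pow]
    congr 1
    field_simp
  have hl2 : ∀ i, 2 * l i ≤ l (i + 1) := by
    intro i
    rw [hlpow (i + 1), hlpow i, pow_succ', ENNReal.ofReal_mul (by positivity), mul_assoc]
    gcongr
    rw [show (2 : ℝ≥0∞) = ENNReal.ofReal 2 by simp]
    exact ENNReal.ofReal_le_ofReal (le_self_pow₀ (by norm_num) hn)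
  set A : ℕ → Set (Fin n → ℝ) := fun k => {x | l k < ballMax u x} with hA
  have hAm : ∀ k, MeasurableSet (A k) := fun k => (isOpen_lt_ballMax u (l k)).measurableSet
  set b : ℕ → ℝ≥0∞ := fun k => l k * volume (closedBall c₀ (ρ + 4 * R k) ∩ A k) with hb
  have hmain := fun k => lintegral_ballMax_superlevel_le (b := l k) hK
    (s := ρ + 4 * R (k + 1)) (t := ρ + 4 * R k) (R := R k) hu ?_ ?_ ?_
  rotate_left
  · intro c r hr hlt
    by_contra! hcon
    refine absurd hlt (not_lt.2 ?_)
    calc ∫⁻ y in closedBall c r, u y ≤ ∫⁻ y, u y := setLIntegral_le_lintegral _ _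
      _ = I := by rw [hu, lintegral_indicator isClosed_closedBall.measurableSet]
      _ = l k * ENNReal.ofReal ((2 * R k) ^ n) := (hlk k).symm
      _ ≤ l k * volume (closedBall c r) := by
        rw [volume_closedBall_pi c hr.le]
        have := (hR0 k).le
        gcongr
  · rw [hRs]
    linarith
  · rw [hRs]
    linarith [hRle k]
  refine ⟨l, b, ?_, hlpow, ?_, ?_, ?_, ?_⟩
  · simp only [hl, hRdef]
    congr 3
    norm_num
    ring
  · exact fun k => ENNReal.mul_ne_top (hltop k)
      (measure_ne_top_of_subset inter_subset_left (volume_closedBall_ne_top _ _))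
  · calc b 0 ≤ l 0 * volume (closedBall c₀ (128 * R 0)) := by
          simp only [hb]
          gcongr
          refine inter_subset_left.trans (closedBall_subset_closedBall ?_)
          simp only [hRdef]
          norm_num
          linarith
      _ = ENNReal.ofReal (128 ^ n) * I := by
          rw [volume_closedBall_mul c₀ c₀ (by norm_num) (hR0 0).le, ← hlk 0,
            volume_closedBall_pi c₀ (hR0 0).le]
          ring
  · intro k N
    have hsub : ∀ i ∈ Finset.Ico (k + 1) N, closedBall c₀ (ρ + 4 * R i) ∩ A i
        ⊆ closedBall c₀ (ρ + 4 * R (k + 1)) ∩ A k := by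
      intro i hi
      have hki : k + 1 ≤ i := (Finset.mem_Ico.1 hi).1
      refine inter_subset_inter (closedBall_subset_closedBall ?_) fun x hx => ?_
      · have : R i ≤ R (k + 1) :=
          div_le_div_of_nonneg_left (by positivity) (by positivity)
            (pow_le_pow_right₀ (by norm_num) hki)
        linarith
      · have hmono : l k ≤ l i := monotone_nat_of_le_succ
          (fun j => le_trans (by rw [two_mul]; exact le_self_add) (hl2 j)) (by omega)
        exact hmono.trans_lt hx
    calc ∑ i ∈ Finset.Ico (k + 1) N, b i
        = ∑ i ∈ Finset.Ico (k + 1) N, ∫⁻ x in closedBall c₀ (ρ + 4 * R (k + 1)) ∩ A k,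
            (closedBall c₀ (ρ + 4 * R i) ∩ A i).indicator (fun _ => l i) x := by
          refine Finset.sum_congr rfl fun i hi => ?_
          rw [lintegral_indicator_const (isClosed_closedBall.measurableSet.inter (hAm i)),
            Measure.restrict_apply (isClosed_closedBall.measurableSet.inter (hAm i)),
            inter_eq_left.2 (hsub i hi)]
      _ = ∫⁻ x in closedBall c₀ (ρ + 4 * R (k + 1)) ∩ A k, ∑ i ∈ Finset.Ico (k + 1) N,
            (closedBall c₀ (ρ + 4 * R i) ∩ A i).indicator (fun _ => l i) x := by
          rw [lintegral_finsetSum]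
          exact fun i _ => measurable_const.indicator
            (isClosed_closedBall.measurableSet.inter (hAm i))
      _ ≤ ∫⁻ x in closedBall c₀ (ρ + 4 * R (k + 1)) ∩ A k, 2 * ballMax u x := by
          refine lintegral_mono fun x => ?_
          refine le_trans ?_ (sum_range_ite_lt_le hl2 (ballMax u x) N)
          refine (Finset.sum_le_sum fun i _ => ?_).trans (Finset.sum_le_sum_of_subset
            (fun i hi => Finset.mem_range.2 (Finset.mem_Ico.1 hi).2))
          refine indicator_apply_le' (fun hx => ?_) fun _ => zero_le
          rw [if_pos (show l i < ballMax u x from hx.2)]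
      _ = 2 * ∫⁻ x in closedBall c₀ (ρ + 4 * R (k + 1)) ∩ A k, ballMax u x :=
          lintegral_const_mul' _ _ (by simp)
      _ ≤ _ := by
          rw [mul_assoc]
          gcongr
          exact (hmain k).1
  · intro k
    refine le_trans ?_ (hmain k).2
    have hm : MeasurableSet (closedBall c₀ ρ ∩ A k) :=
      isClosed_closedBall.measurableSet.inter (hAm k)
    calc ∫⁻ y in closedBall c₀ ρ ∩ A k, W y ≤ ∫⁻ y in closedBall c₀ ρ ∩ A k, u y := by
          refine setLIntegral_mono' hm fun y hy => ?_
          rw [hu, indicator_of_mem (closedBall_subset_closedBall (by linarith) hy.1)]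
      _ ≤ _ := by
          refine lintegral_mono_set (inter_subset_inter_left _ (closedBall_subset_closedBall ?_))
          linarith [hR0 (k + 1)]

end Levels

section WeightedExp

variable {n : ℕ}

theorem two_pow_le_one_add_inv_pow {J : ℕ} (hJ : 1 ≤ J) (n k : ℕ) :
    ((2 : ℝ) ^ n) ^ k ≤ ((1 + 1 / (J : ℝ)) ^ k) ^ (n * J) := by
  have hJ0 : (0 : ℝ) < J := by exact_mod_cast hJ
  have h2 : (2 : ℝ) ≤ (1 + 1 / (J : ℝ)) ^ J := by
    have := one_add_mul_le_pow (a := 1 / (J : ℝ)) (by linarith [one_div_pos.2 hJ0]) J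
    rwa [mul_one_div_cancel hJ0.ne', one_add_one_eq_two] at this
  calc ((2 : ℝ) ^ n) ^ k ≤ (((1 + 1 / (J : ℝ)) ^ J) ^ n) ^ k := by gcongr
    _ = _ := by
      rw [← pow_mul, ← pow_mul, ← pow_mul]
      ring_nf

theorem sum_tsum_levels_le {b : ℕ → ℝ≥0∞} (hb : ∀ k, b k ≠ ⊤) {κ : ℝ≥0∞} {J : ℕ} (hJ : 1 ≤ J)
    (hκJ : 2 * κ ≤ J) (htail : ∀ k N, ∑ i ∈ Finset.Ico (k + 1) N, b i ≤ κ * b k) :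
    ∑' k, ENNReal.ofReal (1 / (J : ℝ) * (1 + 1 / (J : ℝ)) ^ k) * b k ≤ 3 * b 0 := by
  have hJ0 : (0 : ℝ) < J := by exact_mod_cast hJ
  have hκ : κ ≠ ⊤ := by
    rintro rfl
    simp at hκJ
  refine ENNReal.tsum_le_of_sum_range_le fun N => ?_
  have hreal := sum_geometric_mul_le (b := fun k => (b k).toReal) (η := 1 / (J : ℝ))
    (κ := κ.toReal) (fun _ => ENNReal.toReal_nonneg) (by positivity)
    ((div_le_one hJ0).2 (by exact_mod_cast hJ)) ?_ ?_ N
  · have := ENNReal.ofReal_le_ofReal hreal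
    rw [ENNReal.ofReal_sum_of_nonneg fun i _ => by positivity, ENNReal.ofReal_mul (by norm_num),
      ENNReal.ofReal_toReal (hb 0)] at this
    convert this using 2
    · rw [ENNReal.ofReal_mul (p := 1 / (J : ℝ) * (1 + 1 / (J : ℝ)) ^ _) (by positivity),
        ENNReal.ofReal_toReal (hb _)]
    · simp
  · have := ENNReal.toReal_mono (by simp) hκJ
    rw [ENNReal.toReal_mul] at this
    simp only [ENNReal.toReal_ofNat, ENNReal.toReal_natCast] at this
    rw [one_div_mul_eq_div, div_le_iff₀ hJ0]
    linarith
  · intro k N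
    have := ENNReal.toReal_mono (ENNReal.mul_ne_top hκ (hb k)) (htail k N)
    rwa [ENNReal.toReal_sum fun i _ => hb i, ENNReal.toReal_mul] at this

theorem lintegral_mul_exp_le (hn : n ≠ 0) {W : (Fin n → ℝ) → ℝ≥0∞} (hW : AEMeasurable W volume)
    {K : ℝ≥0∞}
    (hK : ∀ c r, 0 < r → ∫⁻ y in closedBall c r, ballMax ((closedBall c r).indicator W) y
      ≤ K * ∫⁻ y in closedBall c (2 * r), W y)
    {c₀ : Fin n → ℝ} {ρ : ℝ} (hρ : 0 < ρ)
    (hI : ∫⁻ y in closedBall c₀ (2 * ρ), W y ≠ ⊤) {J : ℕ} (hJ : 1 ≤ J)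
    (hKJ : 2 * (2 * (ENNReal.ofReal (30 ^ n) * K + ENNReal.ofReal (15 ^ n))) ≤ J)
    (θ : (Fin n → ℝ) → ℝ) :
    ∫⁻ x in closedBall c₀ ρ, W x * ENNReal.ofReal (Real.exp (θ x))
      ≤ ENNReal.ofReal (1 + 3 * 640 ^ n) * (∫⁻ y in closedBall c₀ (2 * ρ), W y) +
        (∫⁻ y in closedBall c₀ (2 * ρ), W y) / ENNReal.ofReal ((ρ / 32) ^ n) *
          ∫⁻ x in closedBall c₀ ρ, ENNReal.ofReal (Real.exp ((n * J + 1 : ℕ) * θ x)) := by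
  set u := (closedBall c₀ (2 * ρ)).indicator W with hu
  obtain ⟨l, b, hl0, hlpow, hbtop, hb0, htail, hlev⟩ := exists_levels hn hK hρ hu hI
  set I := ∫⁻ y in closedBall c₀ (2 * ρ), W y with hIdef
  rw [← hl0]
  set A : ℕ → Set (Fin n → ℝ) := fun k => {x | l k < ballMax u x} with hA
  have hAm : ∀ k, MeasurableSet (A k) := fun k => (isOpen_lt_ballMax u (l k)).measurableSet
  set η : ℝ := 1 / (J : ℝ) with hη
  have hJ0 : (0 : ℝ) < J := by exact_mod_cast hJ
  have hη0 : 0 < η := by positivity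
  set ψ : (Fin n → ℝ) → ℝ≥0∞ := fun x =>
    1 + ∑' k, (A k).indicator (fun _ => ENNReal.ofReal (η * (1 + η) ^ k)) x with hψ
  have hψm : Measurable ψ := by
    refine Measurable.const_add ?_ 1
    exact Measurable.tsum fun k => measurable_const.indicator (hAm k)
  have hψle : ∀ x k, (∀ i < k, x ∈ A i) → ENNReal.ofReal ((1 + η) ^ k) ≤ ψ x := by
    intro x k hk
    rw [one_add_pow_eq_one_add_sum, ENNReal.ofReal_add zero_le_one
      (Finset.sum_nonneg fun i _ => by positivity), ENNReal.ofReal_one,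
      ENNReal.ofReal_sum_of_nonneg fun i _ => by positivity]
    simp only [hψ]
    gcongr
    refine le_trans (Finset.sum_le_sum fun i hi => ?_) (ENNReal.sum_le_tsum (Finset.range k))
    rw [indicator_of_mem (hk i (Finset.mem_range.1 hi))]
  have hae : ∀ᵐ x, u x ≤ ballMax u x := by
    refine ae_le_ballMax (hW.indicator isClosed_closedBall.measurableSet) ?_
    rwa [hu, lintegral_indicator isClosed_closedBall.measurableSet]
  have hpt : ∀ᵐ x, x ∈ closedBall c₀ ρ → W x * ENNReal.ofReal (Real.exp (θ x))
      ≤ W x * ψ x + l 0 * ENNReal.ofReal (Real.exp ((n * J + 1 : ℕ) * θ x)) := by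
    filter_upwards [hae] with x hx hxQ
    rw [hu, indicator_of_mem (closedBall_subset_closedBall (by linarith) hxQ)] at hx
    have hex : ∃ k : ℕ, Real.exp (θ x) ≤ (1 + η) ^ k :=
      (pow_unbounded_of_one_lt _ (by linarith)).imp fun k hk => hk.le
    classical
    by_cases hall : ∀ i < Nat.find hex, x ∈ A i
    · refine le_add_right ?_
      gcongr
      exact (ENNReal.ofReal_le_ofReal (Nat.find_spec hex)).trans (hψle x _ hall)
    · push Not at hall
      obtain ⟨i, hi, hxi⟩ := hall
      have hlt : (1 + η) ^ i < Real.exp (θ x) := not_le.1 (Nat.find_min hex hi)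
      refine le_add_left ?_
      calc W x * ENNReal.ofReal (Real.exp (θ x)) ≤ l i * ENNReal.ofReal (Real.exp (θ x)) := by
            gcongr
            exact hx.trans (not_lt.1 hxi)
        _ = l 0 * ENNReal.ofReal ((2 ^ n) ^ i * Real.exp (θ x)) := by
            rw [hlpow i, ENNReal.ofReal_mul (by positivity)]
            ring
        _ ≤ _ := by
            gcongr
            rw [Real.exp_nat_mul, pow_succ]
            gcongr
            exact (two_pow_le_one_add_inv_pow hJ n i).trans (by gcongr)
  have hψint : ∫⁻ x in closedBall c₀ ρ, W x * ψ x ≤ ENNReal.ofReal (1 + 3 * 640 ^ n) * I := by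
    have hWr : AEMeasurable W (volume.restrict (closedBall c₀ ρ)) := hW.restrict
    calc ∫⁻ x in closedBall c₀ ρ, W x * ψ x
        = (∫⁻ x in closedBall c₀ ρ, W x) + ∑' k, ∫⁻ x in closedBall c₀ ρ,
            W x * (A k).indicator (fun _ => ENNReal.ofReal (η * (1 + η) ^ k)) x := by
          simp only [hψ, mul_add, mul_one, ← ENNReal.tsum_mul_left]
          rw [lintegral_add_left' hWr, lintegral_tsum]
          exact fun k => hWr.mul (measurable_const.indicator (hAm k)).aemeasurable
      _ ≤ I + ∑' k, ENNReal.ofReal (5 ^ n) * (ENNReal.ofReal (η * (1 + η) ^ k) * b k) := by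
          gcongr with k
          · exact lintegral_mono_set (closedBall_subset_closedBall (by linarith))
          · calc _ = ∫⁻ x in closedBall c₀ ρ,
                  (A k).indicator (fun x => ENNReal.ofReal (η * (1 + η) ^ k) * W x) x := by
                  refine lintegral_congr fun x => ?_
                  by_cases hx : x ∈ A k
                  · rw [indicator_of_mem hx, indicator_of_mem hx, mul_comm]
                  · rw [indicator_of_notMem hx, indicator_of_notMem hx, mul_zero]
              _ = ENNReal.ofReal (η * (1 + η) ^ k) * ∫⁻ x in closedBall c₀ ρ ∩ A k, W x := by
                  rw [lintegral_indicator (hAm k), Measure.restrict_restrict (hAm k), inter_comm,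
                    lintegral_const_mul' _ _ ENNReal.ofReal_ne_top]
              _ ≤ ENNReal.ofReal (η * (1 + η) ^ k) * (ENNReal.ofReal (5 ^ n) * b k) := by
                  gcongr
                  exact hlev k
              _ = _ := mul_left_comm _ _ _
      _ ≤ I + ENNReal.ofReal (5 ^ n) * (3 * (ENNReal.ofReal (128 ^ n) * I)) := by
          rw [ENNReal.tsum_mul_left]
          gcongr
          refine (sum_tsum_levels_le hbtop hJ hKJ htail).trans ?_
          gcongr
      _ = _ := by
          rw [show (640 : ℝ) = 5 * 128 by norm_num, mul_pow, ENNReal.ofReal_add (by positivity)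
            (by positivity), ENNReal.ofReal_mul (by positivity), ENNReal.ofReal_mul (by positivity)]
          simp only [ENNReal.ofReal_one, ENNReal.ofReal_ofNat]
          ring
  calc ∫⁻ x in closedBall c₀ ρ, W x * ENNReal.ofReal (Real.exp (θ x))
      ≤ ∫⁻ x in closedBall c₀ ρ,
          (W x * ψ x + l 0 * ENNReal.ofReal (Real.exp ((n * J + 1 : ℕ) * θ x))) :=
        lintegral_mono_ae ((ae_restrict_iff' isClosed_closedBall.measurableSet).2 hpt)
    _ = (∫⁻ x in closedBall c₀ ρ, W x * ψ x) +
          ∫⁻ x in closedBall c₀ ρ, l 0 * ENNReal.ofReal (Real.exp ((n * J + 1 : ℕ) * θ x)) :=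
        lintegral_add_left' (hW.restrict.mul hψm.aemeasurable) _
    _ ≤ _ := by
        rw [lintegral_const_mul' _ _ (by
          rw [hl0]
          exact ENNReal.div_ne_top hI (ENNReal.ofReal_pos.2 (by positivity)).ne')]
        gcongr

end WeightedExp

section JohnNirenberg

variable {n : ℕ}

theorem enorm_average_sub_mul_le {f : (Fin n → ℝ) → ℝ} (hf : LocallyIntegrable f volume)
    (c : Fin n → ℝ) {r : ℝ} (hr : 0 < r) (k : ℝ) :
    ENNReal.ofReal |(⨍ x in closedBall c r, f x) - k| * volume (closedBall c r)
      ≤ ∫⁻ x in closedBall c r, ENNReal.ofReal |f x - k| := by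
  have hfi : IntegrableOn f (closedBall c r) volume :=
    hf.integrableOn_isCompact (isCompact_closedBall c r)
  have hV : 0 < volume.real (closedBall c r) :=
    ENNReal.toReal_pos (volume_closedBall_ne_zero c hr) (volume_closedBall_ne_top c r)
  have h_integral : ∫ x in closedBall c r, (f x - k)
      = volume.real (closedBall c r) * ((⨍ x in closedBall c r, f x) - k) := by
    rw [integral_sub hfi (integrableOn_const (volume_closedBall_ne_top c r)), setIntegral_const,
      setAverage_eq, smul_eq_mul, smul_eq_mul]
    field_simp
  have hle := enorm_integral_le_lintegral_enorm (μ := volume.restrict (closedBall c r))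
    (fun x => f x - k)
  simp only [Real.enorm_eq_ofReal_abs] at hle
  refine le_trans (le_of_eq ?_) hle
  rw [h_integral, abs_mul, abs_of_pos hV, ENNReal.ofReal_mul hV.le, mul_comm, ofReal_measureReal
    (volume_closedBall_ne_top c r)]

theorem lintegral_double_sub_average_le {f : (Fin n → ℝ) → ℝ} (hf : LocallyIntegrable f volume)
    {B : ℝ} (hB : 0 < B)
    (hosc : ∀ c r, 0 < r → ∫⁻ x in closedBall c r, ENNReal.ofReal |f x - ⨍ y in closedBall c r, f y|
      ≤ ENNReal.ofReal B * volume (closedBall c r))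
    (c : Fin n → ℝ) {ρ : ℝ} (hρ : 0 < ρ) :
    ∫⁻ x in closedBall c (2 * ρ), ENNReal.ofReal |f x - ⨍ y in closedBall c ρ, f y|
      ≤ ENNReal.ofReal (2 * 4 ^ n * B) * volume (closedBall c ρ) := by
  set m := ⨍ y in closedBall c ρ, f y
  set m₂ := ⨍ y in closedBall c (2 * ρ), f y
  have h2 : ∫⁻ x in closedBall c (2 * ρ), ENNReal.ofReal |f x - m₂|
      ≤ ENNReal.ofReal (2 ^ n * B) * volume (closedBall c ρ) := by
    refine (hosc c (2 * ρ) (by positivity)).trans_eq ?_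
    rw [volume_closedBall_mul c c (by norm_num) hρ.le, ENNReal.ofReal_mul (by positivity)]
    ring
  have hm : ENNReal.ofReal |m - m₂| ≤ ENNReal.ofReal (2 ^ n * B) := by
    rw [← ENNReal.mul_le_mul_iff_left (volume_closedBall_ne_zero c hρ)
      (volume_closedBall_ne_top c ρ)]
    exact (enorm_average_sub_mul_le hf c hρ m₂).trans
      ((lintegral_mono_set (closedBall_subset_closedBall (by linarith))).trans h2)
  calc ∫⁻ x in closedBall c (2 * ρ), ENNReal.ofReal |f x - m|
      ≤ ∫⁻ x in closedBall c (2 * ρ),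
          (ENNReal.ofReal |f x - m₂| + ENNReal.ofReal |m - m₂|) := by
        refine lintegral_mono fun x => ?_
        rw [← ENNReal.ofReal_add (abs_nonneg _) (abs_nonneg _), abs_sub_comm m m₂]
        exact ENNReal.ofReal_le_ofReal (abs_sub_le _ _ _)
    _ = (∫⁻ x in closedBall c (2 * ρ), ENNReal.ofReal |f x - m₂|) +
          ENNReal.ofReal |m - m₂| * volume (closedBall c (2 * ρ)) := by
        rw [lintegral_add_right _ measurable_const, setLIntegral_const]
    _ ≤ ENNReal.ofReal (2 ^ n * B) * volume (closedBall c ρ) + ENNReal.ofReal (2 ^ n * B) *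
          (ENNReal.ofReal (2 ^ n) * volume (closedBall c ρ)) := by
        rw [volume_closedBall_mul c c (by norm_num) hρ.le]
        gcongr
    _ = ENNReal.ofReal (2 ^ n * B + 2 ^ n * B * 2 ^ n) * volume (closedBall c ρ) := by
        rw [ENNReal.ofReal_add (by positivity) (by positivity),
          ENNReal.ofReal_mul (p := 2 ^ n * B) (by positivity)]
        ring
    _ ≤ _ := by
        gcongr
        rw [show (4 : ℝ) = 2 * 2 by norm_num, mul_pow]
        have : (1 : ℝ) ≤ 2 ^ n := one_le_pow₀ (by norm_num)
        have h3 : (0 : ℝ) ≤ 2 ^ n * B := by positivity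
        nlinarith

/-- The John–Nirenberg inequality in iterated form. -/
theorem volume_superlevel_sub_average_le {f : (Fin n → ℝ) → ℝ} (hf : LocallyIntegrable f volume)
    {B L : ℝ} (hB : 0 < B) (hL : L = 4 * 24 ^ n * B)
    (hosc : ∀ c r, 0 < r → ∫⁻ x in closedBall c r, ENNReal.ofReal |f x - ⨍ y in closedBall c r, f y|
      ≤ ENNReal.ofReal B * volume (closedBall c r)) (k : ℕ) :
    ∀ (c : Fin n → ℝ) (ρ : ℝ), 0 < ρ →
      volume (closedBall c ρ ∩ {x | k * L < |f x - ⨍ y in closedBall c ρ, f y|})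
        ≤ ENNReal.ofReal ((1 / 2) ^ k) * volume (closedBall c ρ) := by
  have hL0 : 0 < L := by rw [hL]; positivity
  induction k with
  | zero =>
    intro c ρ _
    simpa using measure_mono inter_subset_left
  | succ k ih =>
    intro c ρ hρ
    set m := ⨍ y in closedBall c ρ, f y with hm
    set v : (Fin n → ℝ) → ℝ≥0∞ :=
      (closedBall c (2 * ρ)).indicator fun x => ENNReal.ofReal |f x - m| with hv
    have hfm : AEMeasurable f volume := hf.aestronglyMeasurable.aemeasurable
    have hvm : AEMeasurable v volume :=
      ((hfm.sub_const m).norm.ennreal_ofReal).indicator isClosed_closedBall.measurableSet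
    have hvint : ∫⁻ x, v x ≤ ENNReal.ofReal (2 * 4 ^ n * B) * volume (closedBall c ρ) := by
      rw [hv, lintegral_indicator isClosed_closedBall.measurableSet]
      exact lintegral_double_sub_average_le hf hB hosc c hρ
    have hvtop : ∫⁻ x, v x ≠ ⊤ :=
      (hvint.trans_lt (ENNReal.mul_lt_top ENNReal.ofReal_lt_top
        (volume_closedBall_ne_top c ρ).lt_top)).ne
    have hR : ∀ c' r, 0 < r → ENNReal.ofReal L * volume (closedBall c' r)
        < ∫⁻ y in closedBall c' r, v y → r ≤ ρ / 6 := by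
      intro c' r hr hlt
      by_contra! hcon
      refine absurd (hlt.trans_le ((setLIntegral_le_lintegral _ _).trans hvint)) (not_lt.2 ?_)
      rw [volume_closedBall_pi c hρ.le, volume_closedBall_pi c' hr.le,
        ← ENNReal.ofReal_mul (by positivity), ← ENNReal.ofReal_mul hL0.le]
      refine ENNReal.ofReal_le_ofReal ?_
      calc 2 * 4 ^ n * B * (2 * ρ) ^ n ≤ 2 * 4 ^ n * B * (2 * (6 * r)) ^ n := by
            gcongr
            linarith
        _ = 2 * 24 ^ n * B * (2 * r) ^ n := by
            rw [show (24 : ℝ) = 4 * 6 by norm_num]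
            simp only [mul_pow]
            ring
        _ ≤ L * (2 * r) ^ n := by
            rw [hL]
            gcongr
            norm_num
    obtain ⟨T, c', r, hTS, hT, hd, hcov, hsel⟩ := exists_disjoint_almost_maximal_balls v
      (ENNReal.ofReal L) (ρ / 6) hR (closedBall c ρ ∩ {x | ENNReal.ofReal L < ballMax v x})
      fun x hx => hx.2
    have : Countable T := hT.to_subtype
    have hsum : ENNReal.ofReal (5 ^ n) * ∑' x : T, volume (closedBall (c' x) (r x))
        ≤ ENNReal.ofReal (1 / 2) * volume (closedBall c ρ) := by
      have h1 : ENNReal.ofReal L * ∑' x : T, volume (closedBall (c' x) (r x))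
          ≤ ENNReal.ofReal (2 * 4 ^ n * B) * volume (closedBall c ρ) := by
        refine le_trans ?_ hvint
        rw [← ENNReal.tsum_mul_left]
        calc _ ≤ ∑' x : T, ∫⁻ y in closedBall (c' x) (r x), v y :=
              ENNReal.tsum_le_tsum fun x => (hsel x x.2).2.2.2.1.le
          _ = ∫⁻ y in ⋃ x ∈ T, closedBall (c' x) (r x), v y :=
              (lintegral_biUnion hT (fun _ _ => isClosed_closedBall.measurableSet) hd v).symm
          _ ≤ _ := setLIntegral_le_lintegral _ _
      have hL' : ENNReal.ofReal (5 ^ n) ≤ ENNReal.ofReal (5 ^ n / L) * ENNReal.ofReal L := by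
        rw [← ENNReal.ofReal_mul (by positivity), div_mul_cancel₀ _ hL0.ne']
      calc _ ≤ ENNReal.ofReal (5 ^ n / L) * ENNReal.ofReal L *
              ∑' x : T, volume (closedBall (c' x) (r x)) := by gcongr
        _ ≤ ENNReal.ofReal (5 ^ n / L) *
              (ENNReal.ofReal (2 * 4 ^ n * B) * volume (closedBall c ρ)) := by
            rw [mul_assoc]
            gcongr
        _ ≤ _ := by
            rw [← mul_assoc, ← ENNReal.ofReal_mul (by positivity)]
            gcongr
            rw [div_mul_eq_mul_div, div_le_iff₀ hL0, hL]
            have : (5 : ℝ) ^ n * 4 ^ n ≤ 24 ^ n := by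
              rw [← mul_pow]
              gcongr
              norm_num
            nlinarith
    have hsub : ∀ᵐ z, z ∈ closedBall c ρ ∩ {x | ((k + 1 : ℕ) : ℝ) * L < |f x - m|} →
        z ∈ ⋃ x : T, closedBall (c' x) (5 * r x) ∩
          {z | k * L < |f z - ⨍ y in closedBall (c' x) (5 * r x), f y|} := by
      filter_upwards [ae_le_ballMax hvm hvtop] with z hz hzQ
      obtain ⟨hzQ, hzk⟩ : z ∈ closedBall c ρ ∧ ((k + 1 : ℕ) : ℝ) * L < |f z - m| := hzQ
      push_cast at hzk
      have hk0 : 0 ≤ (k : ℝ) * L := by positivity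
      have hzv : ENNReal.ofReal L < ballMax v z := by
        refine lt_of_lt_of_le ?_ hz
        rw [hv, indicator_of_mem (closedBall_subset_closedBall (by linarith) hzQ)]
        exact (ENNReal.ofReal_lt_ofReal_iff (by linarith)).2 (by linarith)
      obtain ⟨x, hx, hzx⟩ := mem_iUnion₂.1 (hcov ⟨hzQ, hzv⟩)
      obtain ⟨h0, hrR, hxc, -, hmax⟩ := hsel x hx
      refine mem_iUnion.2 ⟨⟨x, hx⟩, hzx, ?_⟩
      have hav : ENNReal.ofReal |(⨍ y in closedBall (c' x) (5 * r x), f y) - m|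
          ≤ ENNReal.ofReal L := by
        rw [← ENNReal.mul_le_mul_iff_left
          (volume_closedBall_ne_zero (c' x) (by positivity : 0 < 5 * r x))
          (volume_closedBall_ne_top _ _)]
        refine (enorm_average_sub_mul_le hf _ (by positivity) m).trans (le_trans ?_
          (hmax (c' x) (5 * r x) (by linarith) (closedBall_subset_closedBall (by linarith) hxc)))
        refine setLIntegral_mono' isClosed_closedBall.measurableSet fun y hy => ?_
        rw [hv, indicator_of_mem]
        have hxQ := (hTS hx).1
        rw [mem_closedBall] at *
        linarith [dist_triangle y (c' x) c, dist_triangle_left (c' x) c x]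
      rw [ENNReal.ofReal_le_ofReal_iff hL0.le] at hav
      change k * L < |f z - ⨍ y in closedBall (c' x) (5 * r x), f y|
      linarith [abs_sub_le (f z) (⨍ y in closedBall (c' x) (5 * r x), f y) m]
    calc volume (closedBall c ρ ∩ {x | ((k + 1 : ℕ) : ℝ) * L < |f x - m|})
        ≤ ∑' x : T, volume (closedBall (c' x) (5 * r x) ∩
          {z | k * L < |f z - ⨍ y in closedBall (c' x) (5 * r x), f y|}) :=
          (measure_mono_ae hsub).trans (measure_iUnion_le _)
      _ ≤ ∑' x : T, ENNReal.ofReal ((1 / 2) ^ k) *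
            (ENNReal.ofReal (5 ^ n) * volume (closedBall (c' x) (r x))) := by
          refine ENNReal.tsum_le_tsum fun x => ?_
          have h0 := (hsel x x.2).1
          rw [← volume_closedBall_mul (c' x) (c' x) (by norm_num) h0.le]
          exact ih _ _ (by positivity)
      _ = ENNReal.ofReal ((1 / 2) ^ k) *
            (ENNReal.ofReal (5 ^ n) * ∑' x : T, volume (closedBall (c' x) (r x))) := by
          rw [ENNReal.tsum_mul_left, ENNReal.tsum_mul_left]
      _ ≤ ENNReal.ofReal ((1 / 2) ^ k) * (ENNReal.ofReal (1 / 2) * volume (closedBall c ρ)) := by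
          gcongr
      _ = _ := by
          rw [← mul_assoc, ← ENNReal.ofReal_mul (by positivity), pow_succ]

theorem lintegral_exp_sub_average_le {f : (Fin n → ℝ) → ℝ} (hf : LocallyIntegrable f volume)
    {B L : ℝ} (hB : 0 < B) (hL : L = 4 * 24 ^ n * B)
    (hosc : ∀ c r, 0 < r → ∫⁻ x in closedBall c r, ENNReal.ofReal |f x - ⨍ y in closedBall c r, f y|
      ≤ ENNReal.ofReal B * volume (closedBall c r)) (c : Fin n → ℝ) {ρ : ℝ} (hρ : 0 < ρ) :
    ∫⁻ x in closedBall c ρ,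
        ENNReal.ofReal (Real.exp (|f x - ⨍ y in closedBall c ρ, f y| / (4 * L)))
      ≤ 7 * volume (closedBall c ρ) := by
  have hL0 : 0 < L := by rw [hL]; positivity
  set m := ⨍ y in closedBall c ρ, f y with hm
  set A : ℕ → Set (Fin n → ℝ) := fun k => {x | k * L < |f x - m|} with hA
  have hfm : AEMeasurable f volume := hf.aestronglyMeasurable.aemeasurable
  have hAm : ∀ k, NullMeasurableSet (A k) volume := fun k =>
    nullMeasurableSet_lt aemeasurable_const (hfm.sub_const m).norm
  have hq : Real.exp (1 / 4) ≤ 3 / 2 := by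
    have h1 : Real.exp (1 / 4) ^ 4 = Real.exp 1 := by
      rw [← Real.exp_nat_mul]
      norm_num
    refine le_of_pow_le_pow_left₀ (n := 4) (by norm_num) (by norm_num) ?_
    rw [h1]
    linarith [Real.exp_one_lt_d9]
  have hpt : ∀ x, ENNReal.ofReal (Real.exp (|f x - m| / (4 * L)))
      ≤ 1 + ∑' k, (A k).indicator (fun _ => ENNReal.ofReal ((3 / 2) ^ (k + 1))) x := by
    intro x
    rcases Nat.eq_zero_or_pos ⌈|f x - m| / L⌉₊ with h0 | hpos
    · rw [Nat.ceil_eq_zero, div_le_iff₀ hL0, zero_mul] at h0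
      rw [le_antisymm h0 (abs_nonneg _)]
      simp
    · obtain ⟨k, hk⟩ := Nat.exists_eq_succ_of_ne_zero hpos.ne'
      have hxk : x ∈ A k := by
        have : k < ⌈|f x - m| / L⌉₊ := by omega
        rw [Nat.lt_ceil, lt_div_iff₀ hL0] at this
        exact this
      refine le_add_left (le_trans ?_ (ENNReal.le_tsum k))
      rw [indicator_of_mem hxk]
      refine ENNReal.ofReal_le_ofReal ?_
      have hle : |f x - m| / L ≤ (k + 1 : ℕ) := by
        rw [← Nat.succ_eq_add_one, ← hk]
        exact Nat.le_ceil _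
      calc Real.exp (|f x - m| / (4 * L)) ≤ Real.exp ((k + 1 : ℕ) * (1 / 4)) := by
            rw [Real.exp_le_exp, mul_comm 4 L, ← div_div]
            linarith
        _ = Real.exp (1 / 4) ^ (k + 1) := Real.exp_nat_mul _ _
        _ ≤ _ := by gcongr
  have hgeom : ∑' k : ℕ, ENNReal.ofReal ((3 / 2) ^ (k + 1)) * ENNReal.ofReal ((1 / 2) ^ k) = 6 := by
    have : ∀ k : ℕ, ENNReal.ofReal ((3 / 2) ^ (k + 1)) * ENNReal.ofReal ((1 / 2) ^ k)
        = ENNReal.ofReal (3 / 2 * (3 / 4) ^ k) := by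
      intro k
      rw [← ENNReal.ofReal_mul (by positivity), pow_succ', mul_assoc, ← mul_pow]
      norm_num
    simp only [this]
    rw [← ENNReal.ofReal_tsum_of_nonneg (fun k => by positivity)
      ((summable_geometric_of_lt_one (by norm_num) (by norm_num)).mul_left _), tsum_mul_left,
      tsum_geometric_of_lt_one (by norm_num) (by norm_num)]
    norm_num
  calc _ ≤ ∫⁻ x in closedBall c ρ, (1 +
          ∑' k, (A k).indicator (fun _ => ENNReal.ofReal ((3 / 2) ^ (k + 1))) x) :=
        lintegral_mono hpt
    _ = volume (closedBall c ρ) + ∑' k, ENNReal.ofReal ((3 / 2) ^ (k + 1)) *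
          volume (closedBall c ρ ∩ A k) := by
        rw [lintegral_add_left measurable_const, setLIntegral_const, one_mul, lintegral_tsum]
        · congr 2
          ext k
          rw [lintegral_indicator_const₀ ((hAm k).mono_ac Measure.restrict_le_self.absolutelyContinuous),
            Measure.restrict_apply₀ ((hAm k).mono_ac Measure.restrict_le_self.absolutelyContinuous),
            inter_comm]
        · exact fun k => (aemeasurable_const.indicator₀ (hAm k)).restrict
    _ ≤ volume (closedBall c ρ) + ∑' k : ℕ, ENNReal.ofReal ((3 / 2) ^ (k + 1)) *
          (ENNReal.ofReal ((1 / 2) ^ k) * volume (closedBall c ρ)) := by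
        gcongr with k
        exact volume_superlevel_sub_average_le hf hB hL hosc k c ρ hρ
    _ = volume (closedBall c ρ) + 6 * volume (closedBall c ρ) := by
        simp only [← mul_assoc]
        rw [ENNReal.tsum_mul_right, hgeom]
    _ = _ := by ring

end JohnNirenberg

section WeakFujiiWilson

open Filter Topology

variable {n : ℕ}

theorem wInt2_eq (w : (Fin n → ℝ) → ℝ) (a : Fin n → ℝ) {h : ℝ} (hh : 0 ≤ h) :
    wInt2 w a h = ∫⁻ y in closedBall (fun i => a i + h / 2) (2 * (h / 2)), ENNReal.ofReal (w y) := by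
  rw [wInt2, Cube2_eq_closedBall a hh]

theorem IsWeight.setLIntegral_closedBall_ne_top {w : (Fin n → ℝ) → ℝ} (hw : IsWeight w)
    (c : Fin n → ℝ) (r : ℝ) : ∫⁻ y in closedBall c r, ENNReal.ofReal (w y) ≠ ⊤ := by
  have := (hw.2.integrableOn_isCompact (isCompact_closedBall c r)).lintegral_lt_top
  exact this.ne

theorem IsWeight.aemeasurable_ofReal {w : (Fin n → ℝ) → ℝ} (hw : IsWeight w) :
    AEMeasurable (fun y => ENNReal.ofReal (w y)) volume :=
  hw.2.aestronglyMeasurable.aemeasurable.ennreal_ofReal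

theorem IsWeight.lintegral_ballMax_le {w : (Fin n → ℝ) → ℝ} (hw : IsWeight w)
    (c : Fin n → ℝ) {r : ℝ} (hr : 0 < r) :
    ∫⁻ y in closedBall c r, ballMax ((closedBall c r).indicator fun x => ENNReal.ofReal (w x)) y
      ≤ fwWeak w * ∫⁻ y in closedBall c (2 * r), ENNReal.ofReal (w y) := by
  have hind : (fun y => ENNReal.ofReal |(closedBall c r).indicator w y|)
      = (closedBall c r).indicator fun x => ENNReal.ofReal (w x) := by
    ext y
    by_cases hy : y ∈ closedBall c r
    · simp only [indicator_of_mem hy, abs_of_nonneg (hw.1 y)]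
    · simp only [indicator_of_notMem hy, abs_zero, ENNReal.ofReal_zero]
  by_cases h0 : ∫⁻ y in closedBall c (2 * r), ENNReal.ofReal (w y) = 0
  · have hzero : ∀ y, ballMax ((closedBall c r).indicator fun x => ENNReal.ofReal (w x)) y ≤ 0 := by
      intro y
      refine ballMax_le fun c' r' _ _ => ?_
      rw [zero_mul, nonpos_iff_eq_zero, ← nonpos_iff_eq_zero]
      calc _ ≤ ∫⁻ z, (closedBall c r).indicator (fun x => ENNReal.ofReal (w x)) z :=
            setLIntegral_le_lintegral _ _
        _ = ∫⁻ z in closedBall c r, ENNReal.ofReal (w z) :=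
            lintegral_indicator isClosed_closedBall.measurableSet _
        _ ≤ ∫⁻ z in closedBall c (2 * r), ENNReal.ofReal (w z) :=
            lintegral_mono_set (closedBall_subset_closedBall (by linarith))
        _ = 0 := h0
        _ ≤ 0 := le_rfl
    calc _ ≤ ∫⁻ _ in closedBall c r, (0 : ℝ≥0∞) := lintegral_mono hzero
      _ = 0 := lintegral_zero
      _ ≤ _ := zero_le
  · rw [← ENNReal.div_le_iff h0 (hw.setLIntegral_closedBall_ne_top c _)]
    refine le_iSup_of_le (fun i => c i - r) (le_iSup_of_le (2 * r)
      (le_iSup_of_le (by positivity) (le_of_eq ?_)))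
    have h2 : (fun i => c i - r + 2 * r / 2) = c := by
      ext i
      ring
    rw [wInt2_eq _ _ (by positivity), h2, mul_div_cancel_left₀ r two_ne_zero,
      ← closedBall_eq_Cube c hr.le]
    simp only [maxFn_eq_ballMax, hind]

theorem one_le_two_pow_mul_of_lintegral_ballMax_le {W : (Fin n → ℝ) → ℝ≥0∞}
    (hW : AEMeasurable W volume) (hWtop : ∀ x, W x ≠ ⊤)
    (hWloc : ∀ c r, ∫⁻ y in closedBall c r, W y ≠ ⊤) {K : ℝ≥0∞} (hKtop : K ≠ ⊤)
    (hK : ∀ c r, 0 < r → ∫⁻ y in closedBall c r, ballMax ((closedBall c r).indicator W) y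
      ≤ K * ∫⁻ y in closedBall c (2 * r), W y)
    {c₀ : Fin n → ℝ} {R : ℝ} (h0 : ∫⁻ y in closedBall c₀ R, W y ≠ 0) :
    1 ≤ ENNReal.ofReal (2 ^ n) * K := by
  set V := (closedBall c₀ (R + 1)).indicator W with hV
  have hVm : AEMeasurable V volume := hW.indicator isClosed_closedBall.measurableSet
  have hVtop : ∫⁻ y, V y ≠ ⊤ := by
    rw [hV, lintegral_indicator isClosed_closedBall.measurableSet]
    exact hWloc _ _
  obtain ⟨x, hxR, hx0, hxlim⟩ : ∃ x ∈ closedBall c₀ R, W x ≠ 0 ∧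
      Tendsto (fun r => (∫⁻ y in closedBall x r, V y) / volume (closedBall x r)) (𝓝[>] 0)
        (𝓝 (V x)) := by
    by_contra! hcon
    refine h0 ((setLIntegral_congr_fun_ae (g := fun _ => 0) isClosed_closedBall.measurableSet ?_).trans
      lintegral_zero)
    filter_upwards [(Besicovitch.vitaliFamily
      (volume : Measure (Fin n → ℝ))).ae_tendsto_lintegral_div hVm hVtop] with x hx hxR
    by_contra hx0
    exact hcon x hxR hx0 (hx.comp (Besicovitch.tendsto_filterAt volume x))
  have hVx : V x = W x := indicator_of_mem (closedBall_subset_closedBall (by linarith) hxR) _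
  rw [hVx] at hxlim
  have hVW : ∀ s, s ≤ 1 → ∫⁻ y in closedBall x s, V y = ∫⁻ y in closedBall x s, W y := by
    intro s hs
    refine setLIntegral_congr_fun isClosed_closedBall.measurableSet fun y hy => ?_
    refine indicator_of_mem ?_ _
    rw [mem_closedBall] at *
    linarith [dist_triangle y x c₀]
  have hlim2 : Tendsto (fun r : ℝ => 2 * r) (𝓝[>] 0) (𝓝[>] 0) := by
    refine tendsto_nhdsWithin_iff.2 ⟨?_, ?_⟩
    · have : Tendsto (fun r : ℝ => 2 * r) (𝓝 0) (𝓝 (2 * 0)) := tendsto_id.const_mul 2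
      rw [mul_zero] at this
      exact this.mono_left nhdsWithin_le_nhds
    · filter_upwards [self_mem_nhdsWithin] with r hr
      exact mul_pos two_pos (mem_Ioi.1 hr)
  have hle : W x ≤ ENNReal.ofReal (2 ^ n) * K * W x := by
    refine le_of_tendsto_of_tendsto hxlim
      (ENNReal.Tendsto.const_mul (hxlim.comp hlim2) (Or.inr ?_)) ?_
    · exact ENNReal.mul_ne_top ENNReal.ofReal_ne_top hKtop
    · filter_upwards [Ioo_mem_nhdsGT (show (0 : ℝ) < 1 / 2 by norm_num)] with r hr
      obtain ⟨hr0, hr1⟩ := hr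
      have hind : ∫⁻ y, (closedBall x r).indicator W y ≠ ⊤ := by
        rw [lintegral_indicator isClosed_closedBall.measurableSet]
        exact hWloc _ _
      have hmain : ∫⁻ y in closedBall x r, W y ≤ K * ∫⁻ y in closedBall x (2 * r), W y := by
        refine le_trans ?_ (hK x r hr0)
        refine setLIntegral_mono_ae' isClosed_closedBall.measurableSet ?_
        filter_upwards [ae_le_ballMax (hW.indicator isClosed_closedBall.measurableSet) hind]
          with y hy hyr
        rwa [indicator_of_mem hyr] at hy
      have hne := volume_closedBall_ne_zero x hr0
      have hnt := volume_closedBall_ne_top x r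
      have hp0 : ENNReal.ofReal (2 ^ n) ≠ 0 := by simp
      simp only [Function.comp_apply]
      rw [hVW r (by linarith), hVW (2 * r) (by linarith), ENNReal.div_le_iff hne hnt,
        volume_closedBall_mul x x zero_le_two hr0.le]
      refine hmain.trans (le_of_eq ?_)
      have hc : volume (closedBall x r) * (volume (closedBall x r))⁻¹ = 1 :=
        ENNReal.mul_inv_cancel hne hnt
      have hd : ENNReal.ofReal (2 ^ n) * (ENNReal.ofReal (2 ^ n))⁻¹ = 1 :=
        ENNReal.mul_inv_cancel hp0 ENNReal.ofReal_ne_top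
      rw [div_eq_mul_inv, ENNReal.mul_inv (Or.inl hp0) (Or.inr hne)]
      calc K * ∫⁻ y in closedBall x (2 * r), W y
          = (ENNReal.ofReal (2 ^ n) * (ENNReal.ofReal (2 ^ n))⁻¹) *
            (volume (closedBall x r) * (volume (closedBall x r))⁻¹) *
            (K * ∫⁻ y in closedBall x (2 * r), W y) := by rw [hc, hd, one_mul, one_mul]
        _ = _ := by ring
  rw [← ENNReal.mul_le_mul_iff_left hx0 (hWtop x), one_mul]
  exact hle

end WeakFujiiWilson

section ExponentialIntegrability

variable {n : ℕ}

theorem exp_div_sub_one_le {c t : ℝ} (hc : 1 ≤ c) :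
    Real.exp (t / c) - 1 ≤ Real.exp t / c := by
  have hc0 : 0 < c := by linarith
  obtain ⟨-, hconv⟩ := convexOn_exp
  have h1 := hconv (mem_univ t) (mem_univ 0) (by positivity : 0 ≤ 1 / c)
    (sub_nonneg.2 ((div_le_one hc0).2 hc) : 0 ≤ 1 - 1 / c) (by ring)
  simp only [smul_eq_mul, mul_zero, add_zero, Real.exp_zero, mul_one] at h1
  have h2 : 0 < 1 / c := by positivity
  have e1 : 1 / c * t = t / c := by ring
  have e2 : 1 / c * Real.exp t = Real.exp t / c := by ring
  rw [e1, e2] at h1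
  linarith

theorem lintegral_inv_smul_wMeasureOn {w : (Fin n → ℝ) → ℝ} (hw : IsWeight w)
    (Q : Set (Fin n → ℝ)) (b : ℝ≥0∞) {g : (Fin n → ℝ) → ℝ≥0∞}
    (hg : AEMeasurable g (volume.restrict Q)) :
    ∫⁻ x, g x ∂(b • wMeasureOn w Q) = b * ∫⁻ x in Q, ENNReal.ofReal (w x) * g x := by
  rw [lintegral_smul_measure, wMeasureOn, lintegral_withDensity_eq_lintegral_mul₀
    hw.aemeasurable_ofReal.restrict hg]
  rfl

theorem expLuxNorm_le {X : Type*} [MeasurableSpace X] {μ : Measure X} {β : ℝ} {g : X → ℝ}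
    {lam : ℝ} (hlam : 0 < lam)
    (h : ∫⁻ x, ENNReal.ofReal (Real.exp ((|g x| / lam) ^ β) - 1) ∂μ ≤ 1) :
    expLuxNorm μ β g ≤ ENNReal.ofReal lam :=
  iInf_le_of_le lam (iInf_le_of_le hlam (iInf_le_of_le h le_rfl))

theorem expLuxNorm_eq_zero {X : Type*} [MeasurableSpace X] {μ : Measure X} {β : ℝ} {g : X → ℝ}
    (h : ∀ lam : ℝ, 0 < lam → ∫⁻ x, ENNReal.ofReal (Real.exp ((|g x| / lam) ^ β) - 1) ∂μ ≤ 1) :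
    expLuxNorm μ β g = 0 := by
  rw [← nonpos_iff_eq_zero]
  refine ENNReal.le_of_forall_pos_le_add fun ε hε _ => ?_
  rw [zero_add, ← ENNReal.ofReal_coe_nnreal]
  exact expLuxNorm_le hε (h ε hε)

theorem lintegral_abs_sub_average_le_of_bmoNorm_le {f : (Fin n → ℝ) → ℝ} {B : ℝ}
    (hB : bmoNorm f ≤ ENNReal.ofReal B) (c : Fin n → ℝ) {r : ℝ} (hr : 0 < r) :
    ∫⁻ x in closedBall c r, ENNReal.ofReal |f x - ⨍ y in closedBall c r, f y|
      ≤ ENNReal.ofReal B * volume (closedBall c r) := by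
  rw [← ENNReal.div_le_iff (volume_closedBall_ne_zero c hr) (volume_closedBall_ne_top c r)]
  refine le_trans ?_ hB
  refine le_iSup_of_le (fun i => c i - r) (le_iSup_of_le (2 * r)
    (le_iSup_of_le (by positivity) (le_of_eq ?_)))
  rw [cubeAvg, ← closedBall_eq_Cube c hr.le]

theorem expLuxNorm_sub_cubeAvg_le (hn : n ≠ 0) {w f : (Fin n → ℝ) → ℝ} (hw : IsWeight w)
    (hK : fwWeak w ≠ ⊤) (hf : LocallyIntegrable f volume) {B : ℝ} (hB : 0 < B)
    (hfB : bmoNorm f ≤ ENNReal.ofReal B) (a : Fin n → ℝ) {h : ℝ} (hh : 0 < h)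
    (h0 : wInt2 w a h ≠ 0) :
    expLuxNorm ((wInt2 w a h)⁻¹ • wMeasureOn w (Cube a h)) 1 (fun x => f x - cubeAvg a h f)
      ≤ ENNReal.ofReal ((1 + 3 * 640 ^ n + 7 * 64 ^ n) * ((n + 1) * (8 * 30 ^ n + 2 ^ n) *
          (16 * 24 ^ n))) * fwWeak w * ENNReal.ofReal B := by
  set W : (Fin n → ℝ) → ℝ≥0∞ := fun x => ENNReal.ofReal (w x) with hWdef
  set K := fwWeak w with hKdef
  have hbm := fun c r hr => hw.lintegral_ballMax_le c (r := r) hr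
  set c : Fin n → ℝ := fun i => a i + h / 2 with hc
  set ρ : ℝ := h / 2 with hρdef
  have hρ : 0 < ρ := half_pos hh
  rw [wInt2_eq w a hh.le] at h0 ⊢
  set I := ∫⁻ y in closedBall c (2 * ρ), ENNReal.ofReal (w y) with hIdef
  have hItop : I ≠ ⊤ := hw.setLIntegral_closedBall_ne_top c _
  have hlow : 1 ≤ ENNReal.ofReal (2 ^ n) * K :=
    one_le_two_pow_mul_of_lintegral_ballMax_le hw.aemeasurable_ofReal
      (fun _ => ENNReal.ofReal_ne_top) hw.setLIntegral_closedBall_ne_top hK hbm h0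
  obtain ⟨k, hk0, hk⟩ : ∃ k : ℝ, 0 ≤ k ∧ K = ENNReal.ofReal k :=
    ⟨K.toReal, ENNReal.toReal_nonneg, (ENNReal.ofReal_toReal hK).symm⟩
  rw [hk, ← ENNReal.ofReal_mul (by positivity), ENNReal.one_le_ofReal] at hlow
  set J := ⌈8 * 30 ^ n * k⌉₊ with hJdef
  have hJlow : 8 * 30 ^ n * k ≤ J := Nat.le_ceil _
  have hJup : (J : ℝ) ≤ (8 * 30 ^ n + 2 ^ n) * k := by
    have := (Nat.ceil_lt_add_one (a := 8 * 30 ^ n * k) (by positivity)).le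
    rw [← hJdef] at this
    linarith
  have hkpos : 0 < k := by
    rcases hk0.eq_or_lt with h | h
    · rw [← h, mul_zero] at hlow
      linarith
    · exact h
  have hJ : 1 ≤ J := Nat.one_le_iff_ne_zero.2 (Nat.ceil_pos.2 (by positivity)).ne'
  have hKJ : 2 * (2 * (ENNReal.ofReal (30 ^ n) * K + ENNReal.ofReal (15 ^ n))) ≤ (J : ℝ≥0∞) := by
    rw [hk, ← ENNReal.ofReal_mul (by positivity), ← ENNReal.ofReal_add (by positivity)
      (by positivity), ← ENNReal.ofReal_ofNat 2, ← ENNReal.ofReal_mul (by positivity),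
      ← ENNReal.ofReal_mul (by positivity), ← ENNReal.ofReal_natCast]
    refine ENNReal.ofReal_le_ofReal (le_trans ?_ hJlow)
    have : (30 : ℝ) ^ n = 15 ^ n * 2 ^ n := by
      rw [← mul_pow]
      norm_num
    have h15 : (0 : ℝ) < 15 ^ n := by positivity
    have := mul_le_mul_of_nonneg_left hlow h15.le
    nlinarith
  set L : ℝ := 4 * 24 ^ n * B with hL
  have hLpos : 0 < L := by positivity
  set Λ : ℝ := (n * J + 1 : ℕ) * (4 * L) with hΛ
  have hΛpos : 0 < Λ := by positivity
  have hQ : Cube a h = closedBall c ρ := Cube_eq_closedBall a hh.le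
  set m := ⨍ y in closedBall c ρ, f y with hm
  have havg : cubeAvg a h f = m := by rw [cubeAvg, hQ]
  rw [hQ, havg]
  set C₃ : ℝ := 1 + 3 * 640 ^ n + 7 * 64 ^ n with hC₃
  have hC₃1 : 1 ≤ C₃ := by
    have : (0 : ℝ) ≤ 3 * 640 ^ n + 7 * 64 ^ n := by positivity
    linarith
  have hexp : ∫⁻ x in closedBall c ρ, W x * ENNReal.ofReal (Real.exp (|f x - m| / Λ))
      ≤ ENNReal.ofReal C₃ * I := by
    refine (lintegral_mul_exp_le hn hw.aemeasurable_ofReal hbm hρ hItop hJ hKJ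
      fun x => |f x - m| / Λ).trans ?_
    have hJN := lintegral_exp_sub_average_le hf hB hL
      (fun c r hr => lintegral_abs_sub_average_le_of_bmoNorm_le hfB c hr) c hρ
    have harg : ∀ x, ((n * J + 1 : ℕ) : ℝ) * (|f x - m| / Λ) = |f x - m| / (4 * L) := by
      intro x
      rw [hΛ]
      field_simp
    simp only [harg]
    have hvol : I / ENNReal.ofReal ((ρ / 32) ^ n) * (7 * volume (closedBall c ρ))
        = ENNReal.ofReal (7 * 64 ^ n) * I := by
      have e : (2 * ρ) ^ n = 64 ^ n * (ρ / 32) ^ n := by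
        rw [← mul_pow]
        congr 1
        ring
      rw [volume_closedBall_pi c hρ.le, e, ENNReal.ofReal_mul (by positivity),
        ENNReal.ofReal_mul (by positivity), ENNReal.ofReal_ofNat, div_eq_mul_inv]
      have hx : (ENNReal.ofReal ((ρ / 32) ^ n))⁻¹ * ENNReal.ofReal ((ρ / 32) ^ n) = 1 :=
        ENNReal.inv_mul_cancel (by simpa using by positivity) ENNReal.ofReal_ne_top
      calc _ = ((ENNReal.ofReal ((ρ / 32) ^ n))⁻¹ * ENNReal.ofReal ((ρ / 32) ^ n)) *
            (7 * ENNReal.ofReal (64 ^ n) * I) := by ring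
        _ = _ := by rw [hx, one_mul]
    calc _ ≤ ENNReal.ofReal (1 + 3 * 640 ^ n) * I +
          I / ENNReal.ofReal ((ρ / 32) ^ n) * (7 * volume (closedBall c ρ)) := by gcongr
      _ = _ := by
        rw [hvol, hC₃, ENNReal.ofReal_add (p := 1 + 3 * 640 ^ n) (by positivity) (by positivity), add_mul]
  have hfm : AEMeasurable f volume := hf.aestronglyMeasurable.aemeasurable
  have hlux : expLuxNorm (I⁻¹ • wMeasureOn w (closedBall c ρ)) 1 (fun x => f x - m)
      ≤ ENNReal.ofReal (C₃ * Λ) := by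
    refine expLuxNorm_le (by positivity) ?_
    simp only [Real.rpow_one]
    rw [lintegral_inv_smul_wMeasureOn hw]
    swap
    · have h1 : AEMeasurable (fun x => |f x - m| / (C₃ * Λ)) volume :=
        ((hfm.sub_const m).norm).div_const _
      exact ((Real.measurable_exp.comp_aemeasurable h1).sub_const 1).ennreal_ofReal.restrict
    rw [mul_comm, ← div_eq_mul_inv, ENNReal.div_le_iff h0 hItop, one_mul]
    have hC₃0 : 0 < C₃ := by linarith
    calc _ ≤ ∫⁻ x in closedBall c ρ, ENNReal.ofReal C₃⁻¹ *
          (W x * ENNReal.ofReal (Real.exp (|f x - m| / Λ))) := by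
          refine lintegral_mono fun x => ?_
          change ENNReal.ofReal (w x) * _ ≤ ENNReal.ofReal C₃⁻¹ * (ENNReal.ofReal (w x) * _)
          rw [mul_left_comm (ENNReal.ofReal C₃⁻¹), ← ENNReal.ofReal_mul (p := C₃⁻¹) (by positivity)]
          gcongr
          have := exp_div_sub_one_le (c := C₃) (t := |f x - m| / Λ) hC₃1
          rw [div_div, mul_comm Λ, div_eq_inv_mul (Real.exp _)] at this
          exact this
      _ = ENNReal.ofReal C₃⁻¹ *
          ∫⁻ x in closedBall c ρ, W x * ENNReal.ofReal (Real.exp (|f x - m| / Λ)) :=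
          lintegral_const_mul' _ _ ENNReal.ofReal_ne_top
      _ ≤ ENNReal.ofReal C₃⁻¹ * (ENNReal.ofReal C₃ * I) := by gcongr
      _ = I := by
          rw [← mul_assoc, ← ENNReal.ofReal_mul (by positivity), inv_mul_cancel₀ hC₃0.ne',
            ENNReal.ofReal_one, one_mul]
  refine hlux.trans ?_
  rw [hk, ← ENNReal.ofReal_mul (by positivity), ← ENNReal.ofReal_mul (by positivity)]
  refine ENNReal.ofReal_le_ofReal ?_
  have hJ1 : (1 : ℝ) ≤ J := by exact_mod_cast hJ
  have hnJ : (n : ℝ) * J + 1 ≤ (n + 1) * ((8 * 30 ^ n + 2 ^ n) * k) :=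
    calc (n : ℝ) * J + 1 ≤ (n + 1) * J := by linarith
      _ ≤ _ := by gcongr
  calc C₃ * Λ = C₃ * ((n * J + 1) * (16 * 24 ^ n * B)) := by
        rw [hΛ, hL]
        push_cast
        ring
    _ ≤ C₃ * ((n + 1) * ((8 * 30 ^ n + 2 ^ n) * k) * (16 * 24 ^ n * B)) := by gcongr
    _ = _ := by ring

end ExponentialIntegrability

/-- for `w ∈ A∞^{weak}` and `f ∈ BMO`, for every cube `Q`,
`‖f - f_Q‖_{exp L(Q, w dx/w(2Q))} ≤ C_n [w]^{weak}_{A∞} ‖f‖_BMO`. -/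
theorem stmt11 (n : ℕ) :
    ∃ C : ℝ, 0 < C ∧
      ∀ (w f : (Fin n → ℝ) → ℝ), IsWeight w → fwWeak w < ⊤ →
        LocallyIntegrable f volume → bmoNorm f < ⊤ →
        ∀ (a : Fin n → ℝ) (h : ℝ), 0 < h →
          expLuxNorm ((wInt2 w a h)⁻¹ • wMeasureOn w (Cube a h)) 1
              (fun x => f x - cubeAvg a h f)
            ≤ ENNReal.ofReal C * fwWeak w * bmoNorm f := by

  refine ⟨(1 + 3 * 640 ^ n + 7 * 64 ^ n) * ((n + 1) * (8 * 30 ^ n + 2 ^ n) * (16 * 24 ^ n)),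
    by positivity, fun w f hw hK hf hb a h hh => ?_⟩
  rcases eq_or_ne n 0 with rfl | hn
  · refine (expLuxNorm_eq_zero fun lam hlam => ?_).trans_le zero_le
    have hconst : ∀ x, f x - cubeAvg a h f = 0 := by
      intro x
      have hfx : f = fun _ => f x := funext fun y => congrArg f (Subsingleton.elim y x)
      have hvol0 : volume (Cube a h) ≠ 0 := by
        rw [Cube_eq_closedBall a hh.le]
        exact volume_closedBall_ne_zero _ (half_pos hh)
      have hvolt : volume (Cube a h) ≠ ⊤ := by
        rw [Cube_eq_closedBall a hh.le]
        exact volume_closedBall_ne_top _ _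
      rw [cubeAvg, hfx, setAverage_const hvol0 hvolt, sub_self]
    simp [hconst]
  by_cases h0 : wInt2 w a h = 0
  · refine (expLuxNorm_eq_zero fun lam hlam => ?_).trans_le zero_le
    have hQ : ∫⁻ x in Cube a h, ENNReal.ofReal (w x) = 0 := by
      rw [wInt2_eq w a hh.le] at h0
      rw [Cube_eq_closedBall a hh.le, ← nonpos_iff_eq_zero, ← h0]
      exact lintegral_mono_set (closedBall_subset_closedBall (by linarith))
    have hμ : wMeasureOn w (Cube a h) = 0 := by
      rw [wMeasureOn, withDensity_eq_zero_iff hw.aemeasurable_ofReal.restrict]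
      exact (lintegral_eq_zero_iff' hw.aemeasurable_ofReal.restrict).1 hQ
    rw [hμ, smul_zero, lintegral_zero_measure]
    exact zero_le_one
  set M := ENNReal.ofReal ((1 + 3 * 640 ^ n + 7 * 64 ^ n) *
    ((n + 1) * (8 * 30 ^ n + 2 ^ n) * (16 * 24 ^ n))) * fwWeak w with hM
  have hMtop : M ≠ ⊤ := ENNReal.mul_ne_top ENNReal.ofReal_ne_top hK.ne
  have hlim : Filter.Tendsto (fun ε : ℝ => M * (bmoNorm f + ENNReal.ofReal ε))
      (nhdsWithin 0 (Ioi 0)) (nhds (M * bmoNorm f)) := by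
    have h1 : Filter.Tendsto (fun ε : ℝ => bmoNorm f + ENNReal.ofReal ε) (nhds 0)
        (nhds (bmoNorm f + ENNReal.ofReal 0)) :=
      tendsto_const_nhds.add (ENNReal.continuous_ofReal.tendsto 0)
    rw [ENNReal.ofReal_zero, add_zero] at h1
    exact ENNReal.Tendsto.const_mul (h1.mono_left nhdsWithin_le_nhds) (Or.inr hMtop)
  refine ge_of_tendsto hlim ?_
  filter_upwards [self_mem_nhdsWithin] with ε hε
  have hε0 : 0 < ε := hε
  have hB : bmoNorm f + ENNReal.ofReal ε = ENNReal.ofReal ((bmoNorm f).toReal + ε) := by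
    rw [ENNReal.ofReal_add ENNReal.toReal_nonneg hε0.le, ENNReal.ofReal_toReal hb.ne]
  rw [hB]
  exact expLuxNorm_sub_cubeAvg_le hn hw hK.ne hf
    (add_pos_of_nonneg_of_pos ENNReal.toReal_nonneg hε0) (hB ▸ le_self_add) a hh h0
end
end

section
/- Let Q be a cube in ℝⁿ and b ∈ L¹_{loc}(ℝⁿ). Then there exists a 1/2-sparse family 𝒮 ⊂ 𝒟(Q) of dyadic subcubes of Q and a dimensional constant c_n such that for a.e. x ∈ Q, |b(x) − b_Q| ≤ c_n ∑_{P∈𝒮} ( (1/|P|) ∫_P |b(y) − b_P| dy ) χ_P(x). -/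
open MeasureTheory ENNReal Set

noncomputable section

/-- The parameters (lower corner, side) of the dyadic cube of generation `q.1` and position `q.2`
relative to the cube with lower corner `a` and side `h`. -/
def dyadicParam {n : ℕ} (a : Fin n → ℝ) (h : ℝ) (q : ℕ × (Fin n → ℕ)) : (Fin n → ℝ) × ℝ :=
  (fun i => a i + (q.2 i : ℝ) * (h / 2 ^ q.1), h / 2 ^ q.1)

/-- The position of the dyadic cube of generation `k` containing `x`. -/
def dyadicPos {n : ℕ} (a : Fin n → ℝ) (h : ℝ) (k : ℕ) (x : Fin n → ℝ) : Fin n → ℕ :=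
  fun i => ⌊(x i - a i) / (h / 2 ^ k)⌋₊

/-- The half-open version of a dyadic cube. -/
def dyadicIco {n : ℕ} (a : Fin n → ℝ) (h : ℝ) (q : ℕ × (Fin n → ℕ)) : Set (Fin n → ℝ) :=
  {x | (∀ i, a i ≤ x i) ∧ dyadicPos a h q.1 x = q.2}

/-- The average over the cube `p` of `|b - b_r|`, where `b_r` is the average of `b` over the
cube `r`. -/
def meanDev {n : ℕ} (b : (Fin n → ℝ) → ℝ) (p r : (Fin n → ℝ) × ℝ) : ℝ :=
  ⨍ y in Cube p.1 p.2, |b y - cubeAvg r.1 r.2 b|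

open Classical in
/-- The smallest stopping cube containing a given dyadic cube, where a dyadic cube is stopping if
the mean deviation on it from the average over the previous stopping cube is more than twice the
mean oscillation on the latter. -/
def stopCube {n : ℕ} (a : Fin n → ℝ) (h : ℝ) (b : (Fin n → ℝ) → ℝ) :
    ℕ → (Fin n → ℕ) → ℕ × (Fin n → ℕ)
  | 0, m => (0, m)
  | k + 1, m =>
    if 2 * meanDev b (dyadicParam a h (stopCube a h b k fun i => m i / 2))
          (dyadicParam a h (stopCube a h b k fun i => m i / 2)) <
        meanDev b (dyadicParam a h (k + 1, m))
          (dyadicParam a h (stopCube a h b k fun i => m i / 2))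
    then (k + 1, m) else stopCube a h b k fun i => m i / 2

/-- The points whose dyadic cubes eventually all have `p` as smallest stopping cube. -/
def stopSet {n : ℕ} (a : Fin n → ℝ) (h : ℝ) (b : (Fin n → ℝ) → ℝ) (p : (Fin n → ℝ) × ℝ) :
    Set (Fin n → ℝ) :=
  {x | (∀ i, a i ≤ x i) ∧
    ∃ k₀, ∀ k, k₀ ≤ k → dyadicParam a h (stopCube a h b k (dyadicPos a h k x)) = p}

section

variable {n : ℕ}

theorem cube_eq_Icc (a : Fin n → ℝ) (h : ℝ) : Cube a h = Icc a (fun i => a i + h) := by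
  rw [Cube, Set.pi_univ_Icc]

theorem cube_eq_closedBall (a : Fin n → ℝ) {h : ℝ} (hh : 0 ≤ h) :
    Cube a h = Metric.closedBall (fun i => a i + h / 2) (h / 2) := by
  rw [closedBall_pi _ (by positivity), Cube]
  congr 1
  ext1 i
  rw [Real.closedBall_eq_Icc]
  congr 1 <;> ring

theorem measurableSet_cube (a : Fin n → ℝ) (h : ℝ) : MeasurableSet (Cube a h) := by
  rw [cube_eq_Icc]; exact measurableSet_Icc

theorem volume_cube (a : Fin n → ℝ) (h : ℝ) : volume (Cube a h) = ENNReal.ofReal h ^ n := by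
  rw [Cube, volume_pi_pi]
  simp

theorem volume_cube_ne_top (a : Fin n → ℝ) (h : ℝ) : volume (Cube a h) ≠ ⊤ := by
  rw [volume_cube]; finiteness

theorem volume_real_cube (a : Fin n → ℝ) {h : ℝ} (hh : 0 ≤ h) :
    volume.real (Cube a h) = h ^ n := by
  rw [Measure.real, volume_cube, ENNReal.toReal_pow, ENNReal.toReal_ofReal hh]

theorem integrableOn_cube {b : (Fin n → ℝ) → ℝ} (hb : LocallyIntegrable b volume)
    (a : Fin n → ℝ) (h : ℝ) : IntegrableOn b (Cube a h) := by
  rw [cube_eq_Icc]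
  exact hb.integrableOn_isCompact isCompact_Icc

theorem integrableOn_cube_abs_sub {b : (Fin n → ℝ) → ℝ} (hb : LocallyIntegrable b volume)
    (a : Fin n → ℝ) (h c : ℝ) : IntegrableOn (fun y => |b y - c|) (Cube a h) :=
  ((integrableOn_cube hb a h).sub
    (integrableOn_const (volume_cube_ne_top a h))).abs

theorem meanDev_nonneg (b : (Fin n → ℝ) → ℝ) (p r : (Fin n → ℝ) × ℝ) : 0 ≤ meanDev b p r := by
  rw [meanDev, setAverage_eq]
  exact smul_nonneg (by positivity) (integral_nonneg fun _ => abs_nonneg _)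

theorem meanDev_mul_volume (b : (Fin n → ℝ) → ℝ) {p r : (Fin n → ℝ) × ℝ} (hp : 0 < p.2) :
    meanDev b p r * p.2 ^ n = ∫ y in Cube p.1 p.2, |b y - cubeAvg r.1 r.2 b| := by
  rw [meanDev, setAverage_eq, volume_real_cube _ hp.le, smul_eq_mul]
  field_simp

theorem abs_cubeAvg_sub_le {b : (Fin n → ℝ) → ℝ} (hb : LocallyIntegrable b volume)
    {p r : (Fin n → ℝ) × ℝ} (hp : 0 < p.2) :
    |cubeAvg p.1 p.2 b - cubeAvg r.1 r.2 b| ≤ meanDev b p r := by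
  have hv : 0 < p.2 ^ n := by positivity
  refine le_of_mul_le_mul_right ?_ hv
  rw [meanDev_mul_volume b hp]
  refine le_trans (le_of_eq ?_) (abs_integral_le_integral_abs (μ := volume.restrict _))
  rw [integral_sub (integrableOn_cube hb _ _)
    (integrableOn_const (volume_cube_ne_top _ _)), setIntegral_const,
    volume_real_cube _ hp.le, cubeAvg, setAverage_eq, volume_real_cube _ hp.le]
  rw [← abs_of_pos hv, ← abs_mul, abs_of_pos hv, sub_mul, smul_eq_mul, smul_eq_mul]
  congr 1
  field_simp

theorem dyadicParam_snd_pos (a : Fin n → ℝ) {h : ℝ} (hh : 0 < h) (q : ℕ × (Fin n → ℕ)) :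
    0 < (dyadicParam a h q).2 := by
  simp only [dyadicParam]; positivity

theorem dyadicIco_eq_pi (a : Fin n → ℝ) {h : ℝ} (hh : 0 < h) (q : ℕ × (Fin n → ℕ)) :
    dyadicIco a h q = Set.univ.pi fun i =>
      Ico ((dyadicParam a h q).1 i) ((dyadicParam a h q).1 i + (dyadicParam a h q).2) := by
  have hd : 0 < h / 2 ^ q.1 := by positivity
  ext x
  simp only [dyadicIco, dyadicPos, dyadicParam, mem_ofPred_eq, mem_univ_pi, mem_Ico, funext_iff,
    ← forall_and]
  refine forall_congr' fun i => ?_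
  constructor
  · rintro ⟨h1, h2⟩
    have h0 : 0 ≤ (x i - a i) / (h / 2 ^ q.1) := div_nonneg (by linarith) hd.le
    rw [Nat.floor_eq_iff h0, le_div_iff₀ hd, div_lt_iff₀ hd] at h2
    constructor <;> linarith
  · rintro ⟨h1, h2⟩
    have hm : 0 ≤ (q.2 i : ℝ) * (h / 2 ^ q.1) := by positivity
    have h3 : a i ≤ x i := by linarith
    have h0 : 0 ≤ (x i - a i) / (h / 2 ^ q.1) := div_nonneg (by linarith) hd.le
    refine ⟨h3, ?_⟩
    rw [Nat.floor_eq_iff h0, le_div_iff₀ hd, div_lt_iff₀ hd]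
    constructor <;> linarith

theorem dyadicIco_ae_eq (a : Fin n → ℝ) {h : ℝ} (hh : 0 < h) (q : ℕ × (Fin n → ℕ)) :
    dyadicIco a h q =ᵐ[volume] Cube (dyadicParam a h q).1 (dyadicParam a h q).2 := by
  rw [dyadicIco_eq_pi a hh, cube_eq_Icc]
  exact Measure.univ_pi_Ico_ae_eq_Icc

theorem dyadicIco_subset (a : Fin n → ℝ) {h : ℝ} (hh : 0 < h) (q : ℕ × (Fin n → ℕ)) :
    dyadicIco a h q ⊆ Cube (dyadicParam a h q).1 (dyadicParam a h q).2 := by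
  rw [dyadicIco_eq_pi a hh]
  exact Set.pi_mono fun i _ => Ico_subset_Icc_self

theorem measurableSet_dyadicIco (a : Fin n → ℝ) {h : ℝ} (hh : 0 < h) (q : ℕ × (Fin n → ℕ)) :
    MeasurableSet (dyadicIco a h q) := by
  rw [dyadicIco_eq_pi a hh]
  exact MeasurableSet.univ_pi fun i => measurableSet_Ico

theorem measurable_dyadicPos (a : Fin n → ℝ) (h : ℝ) (k : ℕ) :
    Measurable (dyadicPos a h k) := by
  refine measurable_pi_lambda _ fun i => ?_
  exact Nat.measurable_floor.comp (((measurable_pi_apply i).sub_const _).div_const _)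

theorem dyadicPos_succ_div_two (a : Fin n → ℝ) (h : ℝ) (k : ℕ) (x : Fin n → ℝ) :
    (fun i => dyadicPos a h (k + 1) x i / 2) = dyadicPos a h k x := by
  funext i
  simp only [dyadicPos]
  rw [← Nat.floor_div_ofNat]
  congr 1
  by_cases hh : h = 0
  · simp [hh]
  field_simp
  ring

theorem cube_succ_subset (a : Fin n → ℝ) {h : ℝ} (hh : 0 < h) (k : ℕ) (m : Fin n → ℕ) :
    Cube (dyadicParam a h (k + 1, m)).1 (dyadicParam a h (k + 1, m)).2 ⊆
      Cube (dyadicParam a h (k, fun i => m i / 2)).1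
        (dyadicParam a h (k, fun i => m i / 2)).2 := by
  refine Set.pi_mono fun i _ => Icc_subset_Icc ?_ ?_
  all_goals
    simp only [dyadicParam]
    have hd : h / 2 ^ k = 2 * (h / 2 ^ (k + 1)) := by field_simp; ring
    have hp : 0 < h / 2 ^ (k + 1) := by positivity
    rw [hd]
    generalize h / 2 ^ (k + 1) = d at hp
  · have : ((m i / 2 : ℕ) : ℝ) * 2 ≤ m i := by exact_mod_cast Nat.div_mul_le_self _ _
    nlinarith
  · have : (m i : ℝ) ≤ 2 * ((m i / 2 : ℕ) : ℝ) + 1 := by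
      have : m i ≤ 2 * (m i / 2) + 1 := by omega
      exact_mod_cast this
    nlinarith

theorem meanDev_succ_le {b : (Fin n → ℝ) → ℝ} (hb : LocallyIntegrable b volume)
    (a : Fin n → ℝ) {h : ℝ} (hh : 0 < h) (k : ℕ) (m : Fin n → ℕ) (r : (Fin n → ℝ) × ℝ) :
    meanDev b (dyadicParam a h (k + 1, m)) r ≤
      2 ^ n * meanDev b (dyadicParam a h (k, fun i => m i / 2)) r := by
  have hp := dyadicParam_snd_pos a hh (k + 1, m)
  have hv : 0 < (dyadicParam a h (k + 1, m)).2 ^ n := by positivity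
  refine le_of_mul_le_mul_right ?_ hv
  have h2 : 2 ^ n * meanDev b (dyadicParam a h (k, fun i => m i / 2)) r *
      (dyadicParam a h (k + 1, m)).2 ^ n =
      meanDev b (dyadicParam a h (k, fun i => m i / 2)) r *
        (dyadicParam a h (k, fun i => m i / 2)).2 ^ n := by
    have : (dyadicParam a h (k, fun i => m i / 2)).2 = 2 * (dyadicParam a h (k + 1, m)).2 := by
      simp only [dyadicParam]; field_simp; ring
    rw [this, mul_pow]; ring
  rw [h2, meanDev_mul_volume b hp, meanDev_mul_volume b (dyadicParam_snd_pos a hh _)]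
  exact setIntegral_mono_set (integrableOn_cube_abs_sub hb _ _ _)
    (Filter.Eventually.of_forall fun _ => abs_nonneg _)
    (cube_succ_subset a hh k m).eventuallyLE

theorem lintegral_dyadicIco {b : (Fin n → ℝ) → ℝ} (hb : LocallyIntegrable b volume)
    (a : Fin n → ℝ) {h : ℝ} (hh : 0 < h) (q : ℕ × (Fin n → ℕ)) (r : (Fin n → ℝ) × ℝ) :
    ∫⁻ y in dyadicIco a h q, ENNReal.ofReal |b y - cubeAvg r.1 r.2 b| =
      ENNReal.ofReal (meanDev b (dyadicParam a h q) r) * volume (dyadicIco a h q) := by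
  have hp := dyadicParam_snd_pos a hh q
  rw [measure_congr (dyadicIco_ae_eq a hh q), setLIntegral_congr (dyadicIco_ae_eq a hh q),
    volume_cube, ← ENNReal.ofReal_pow hp.le, ← ENNReal.ofReal_mul (meanDev_nonneg _ _ _),
    meanDev_mul_volume b hp,
    ofReal_integral_eq_lintegral_ofReal (integrableOn_cube_abs_sub hb _ _ _)
      (Filter.Eventually.of_forall fun _ => abs_nonneg _)]

theorem stopCube_succ_of_lt {a : Fin n → ℝ} {h : ℝ} {b : (Fin n → ℝ) → ℝ} {k : ℕ}
    {m : Fin n → ℕ} {q : ℕ × (Fin n → ℕ)} (hq : stopCube a h b k (fun i => m i / 2) = q)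
    (hlt : 2 * meanDev b (dyadicParam a h q) (dyadicParam a h q) <
      meanDev b (dyadicParam a h (k + 1, m)) (dyadicParam a h q)) :
    stopCube a h b (k + 1) m = (k + 1, m) := by
  subst hq
  rw [stopCube, if_pos hlt]

theorem stopCube_succ_of_not_lt {a : Fin n → ℝ} {h : ℝ} {b : (Fin n → ℝ) → ℝ} {k : ℕ}
    {m : Fin n → ℕ} {q : ℕ × (Fin n → ℕ)} (hq : stopCube a h b k (fun i => m i / 2) = q)
    (hlt : ¬ 2 * meanDev b (dyadicParam a h q) (dyadicParam a h q) <
      meanDev b (dyadicParam a h (k + 1, m)) (dyadicParam a h q)) :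
    stopCube a h b (k + 1) m = q := by
  subst hq
  rw [stopCube, if_neg hlt]

theorem stopCube_fst_le (a : Fin n → ℝ) (h : ℝ) (b : (Fin n → ℝ) → ℝ) (k : ℕ) (m : Fin n → ℕ) :
    (stopCube a h b k m).1 ≤ k := by
  induction k generalizing m with
  | zero => simp [stopCube]
  | succ k ih =>
    rw [stopCube]
    split_ifs
    · exact le_rfl
    · exact (ih _).trans k.le_succ

theorem monotone_stopCube_fst (a : Fin n → ℝ) (h : ℝ) (b : (Fin n → ℝ) → ℝ) (x : Fin n → ℝ) :
    Monotone fun k => (stopCube a h b k (dyadicPos a h k x)).1 := by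
  refine monotone_nat_of_le_succ fun k => ?_
  have := stopCube_fst_le a h b k (dyadicPos a h k x)
  rw [stopCube, dyadicPos_succ_div_two]
  split_ifs
  · exact this.trans k.le_succ
  · exact le_rfl

theorem stopCube_dyadicPos (a : Fin n → ℝ) (h : ℝ) (b : (Fin n → ℝ) → ℝ) (k : ℕ)
    (x : Fin n → ℝ) :
    (stopCube a h b k (dyadicPos a h k x)).2 =
      dyadicPos a h (stopCube a h b k (dyadicPos a h k x)).1 x := by
  induction k with
  | zero => simp [stopCube]
  | succ k ih =>
    rw [stopCube, dyadicPos_succ_div_two]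
    split_ifs
    · rfl
    · exact ih

theorem meanDev_stopCube_le (a : Fin n → ℝ) (h : ℝ) (b : (Fin n → ℝ) → ℝ) (k : ℕ)
    (m : Fin n → ℕ) :
    meanDev b (dyadicParam a h (k, m)) (dyadicParam a h (stopCube a h b k m)) ≤
      2 * meanDev b (dyadicParam a h (stopCube a h b k m))
        (dyadicParam a h (stopCube a h b k m)) := by
  cases k with
  | zero =>
    rw [stopCube]
    linarith [meanDev_nonneg b (dyadicParam a h (0, m)) (dyadicParam a h (0, m))]
  | succ k =>
    rw [stopCube]
    split_ifs with hlt
    · linarith [meanDev_nonneg b (dyadicParam a h (k + 1, m)) (dyadicParam a h (k + 1, m))]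
    · exact not_lt.mp hlt

theorem mem_dyadicIco_stopCube {a : Fin n → ℝ} {h : ℝ} {b : (Fin n → ℝ) → ℝ} {k : ℕ}
    {x : Fin n → ℝ} (hx : ∀ i, a i ≤ x i) :
    x ∈ dyadicIco a h (stopCube a h b k (dyadicPos a h k x)) :=
  ⟨hx, (stopCube_dyadicPos a h b k x).symm⟩

theorem measurableSet_stopSet (a : Fin n → ℝ) (h : ℝ) (b : (Fin n → ℝ) → ℝ)
    (p : (Fin n → ℝ) × ℝ) : MeasurableSet (stopSet a h b p) := by
  have heq : stopSet a h b p = Ici a ∩ ⋃ k₀ : ℕ, ⋂ k, ⋂ _ : k₀ ≤ k,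
      dyadicPos a h k ⁻¹' {m | dyadicParam a h (stopCube a h b k m) = p} := by
    ext x
    simp [stopSet, Pi.le_def]
  rw [heq]
  refine measurableSet_Ici.inter (MeasurableSet.iUnion fun k₀ => MeasurableSet.iInter fun k =>
    MeasurableSet.iInter fun _ => ?_)
  exact measurable_dyadicPos a h k (Set.to_countable _).measurableSet

theorem stopSet_subset (a : Fin n → ℝ) {h : ℝ} (hh : 0 < h) (b : (Fin n → ℝ) → ℝ)
    (p : (Fin n → ℝ) × ℝ) : stopSet a h b p ⊆ Cube p.1 p.2 := by
  rintro x ⟨hx, k, hk⟩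
  rw [← hk k le_rfl]
  exact dyadicIco_subset a hh _ (mem_dyadicIco_stopCube hx)

theorem disjoint_stopSet (a : Fin n → ℝ) (h : ℝ) (b : (Fin n → ℝ) → ℝ)
    {p r : (Fin n → ℝ) × ℝ} (hpr : p ≠ r) : Disjoint (stopSet a h b p) (stopSet a h b r) := by
  rw [Set.disjoint_left]
  rintro x ⟨_, k, hk⟩ ⟨_, l, hl⟩
  exact hpr ((hk (max k l) (le_max_left _ _)).symm.trans (hl (max k l) (le_max_right _ _)))

/-- The stopping cubes whose previous stopping cube is `q`. -/
def stopChildren (a : Fin n → ℝ) (h : ℝ) (b : (Fin n → ℝ) → ℝ) (q : ℕ × (Fin n → ℕ)) :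
    Set (ℕ × (Fin n → ℕ)) :=
  {r | ∃ k m, r = (k + 1, m) ∧ stopCube a h b k (fun i => m i / 2) = q ∧
    2 * meanDev b (dyadicParam a h q) (dyadicParam a h q) <
      meanDev b (dyadicParam a h r) (dyadicParam a h q)}

theorem exists_of_mem_stopChildren {a : Fin n → ℝ} {h : ℝ} {b : (Fin n → ℝ) → ℝ}
    {q r : ℕ × (Fin n → ℕ)} (hr : r ∈ stopChildren a h b q) {x : Fin n → ℝ}
    (hx : x ∈ dyadicIco a h r) :
    ∃ k, r = (k + 1, dyadicPos a h (k + 1) x) ∧ stopCube a h b k (dyadicPos a h k x) = q ∧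
      stopCube a h b (k + 1) (dyadicPos a h (k + 1) x) =
        (k + 1, dyadicPos a h (k + 1) x) := by
  obtain ⟨k, m, rfl, hq, hlt⟩ := hr
  obtain ⟨-, hm⟩ := hx
  simp only at hm
  subst hm
  refine ⟨k, rfl, ?_, stopCube_succ_of_lt hq hlt⟩
  rw [← hq, dyadicPos_succ_div_two]

theorem pairwiseDisjoint_stopChildren (a : Fin n → ℝ) (h : ℝ) (b : (Fin n → ℝ) → ℝ)
    (q : ℕ × (Fin n → ℕ)) : (stopChildren a h b q).PairwiseDisjoint (dyadicIco a h) := by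
  intro r hr s hs hrs
  refine Set.disjoint_left.mpr fun x hxr hxs => hrs ?_
  obtain ⟨k, rfl, hk, hk'⟩ := exists_of_mem_stopChildren hr hxr
  obtain ⟨l, rfl, hl, hl'⟩ := exists_of_mem_stopChildren hs hxs
  have key : ∀ k l, stopCube a h b k (dyadicPos a h k x) = q →
      stopCube a h b (k + 1) (dyadicPos a h (k + 1) x) = (k + 1, dyadicPos a h (k + 1) x) →
      stopCube a h b l (dyadicPos a h l x) = q → l ≤ k := by
    intro k l hk hk' hl
    by_contra! hkl
    have h1 := monotone_stopCube_fst a h b x (Nat.succ_le_of_lt hkl)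
    have h2 := stopCube_fst_le a h b k (dyadicPos a h k x)
    simp only [Nat.succ_eq_add_one, hk', hl] at h1
    rw [hk] at h2
    omega
  obtain rfl := le_antisymm (key l k hl hl' hk) (key k l hk hk' hl)
  rfl

theorem dyadicIco_subset_of_mem_stopChildren {a : Fin n → ℝ} {h : ℝ} {b : (Fin n → ℝ) → ℝ}
    {q r : ℕ × (Fin n → ℕ)} (hr : r ∈ stopChildren a h b q) :
    dyadicIco a h r ⊆ dyadicIco a h q := by
  intro x hx
  obtain ⟨k, -, rfl, -⟩ := exists_of_mem_stopChildren hr hx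
  exact mem_dyadicIco_stopCube hx.1

theorem dyadicIco_subset_union_stopSet (a : Fin n → ℝ) (h : ℝ) (b : (Fin n → ℝ) → ℝ)
    {q : ℕ × (Fin n → ℕ)} (hq : stopCube a h b q.1 q.2 = q) :
    dyadicIco a h q ⊆
      (⋃ r ∈ stopChildren a h b q, dyadicIco a h r) ∪ stopSet a h b (dyadicParam a h q) := by
  intro x hx
  by_cases hu : x ∈ ⋃ r ∈ stopChildren a h b q, dyadicIco a h r
  · exact Or.inl hu
  refine Or.inr ⟨hx.1, q.1, fun k hk => congrArg _ ?_⟩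
  simp only [mem_iUnion, not_exists] at hu
  induction k, hk using Nat.le_induction with
  | base => rw [hx.2, hq]
  | succ k _ ih =>
    rw [← dyadicPos_succ_div_two] at ih
    refine stopCube_succ_of_not_lt ih fun hlt => ?_
    exact hu _ ⟨k, _, rfl, ih, hlt⟩ ⟨hx.1, rfl⟩

theorem two_mul_volume_stopChildren_le {b : (Fin n → ℝ) → ℝ} (hb : LocallyIntegrable b volume)
    (a : Fin n → ℝ) {h : ℝ} (hh : 0 < h) (q : ℕ × (Fin n → ℕ)) :
    2 * volume (⋃ r ∈ stopChildren a h b q, dyadicIco a h r) ≤ volume (dyadicIco a h q) := by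
  set B := stopChildren a h b q
  set p := dyadicParam a h q with hp
  have hsub : (⋃ r ∈ B, dyadicIco a h r) ⊆ dyadicIco a h q :=
    iUnion₂_subset fun r hr => dyadicIco_subset_of_mem_stopChildren hr
  have hmeas : ∀ r ∈ B, MeasurableSet (dyadicIco a h r) :=
    fun r _ => measurableSet_dyadicIco a hh r
  have hdisj := pairwiseDisjoint_stopChildren a h b q
  have hcount : B.Countable := Set.to_countable _
  have hchild : ∀ r ∈ B, 2 * meanDev b p p < meanDev b (dyadicParam a h r) p := by
    rintro r ⟨k, m, rfl, -, hlt⟩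
    exact hlt
  have hle : ENNReal.ofReal (2 * meanDev b p p) * volume (⋃ r ∈ B, dyadicIco a h r) ≤
      ENNReal.ofReal (meanDev b p p) * volume (dyadicIco a h q) := by
    rw [← lintegral_dyadicIco hb a hh q p, measure_biUnion hcount hdisj hmeas,
      ← ENNReal.tsum_mul_left]
    refine le_trans ?_ (lintegral_mono_set hsub)
    rw [lintegral_biUnion hcount hmeas hdisj]
    refine ENNReal.tsum_le_tsum fun r => ?_
    rw [lintegral_dyadicIco hb a hh]
    gcongr
    exact (hchild r r.2).le
  rcases (meanDev_nonneg b p p).eq_or_lt with h0 | hpos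
  · have hempty : B = ∅ := by
      refine Set.eq_empty_of_forall_notMem fun r hr => ?_
      have h1 := lintegral_mono_set (μ := volume)
        (f := fun y => ENNReal.ofReal |b y - cubeAvg p.1 p.2 b|)
        (dyadicIco_subset_of_mem_stopChildren hr)
      rw [lintegral_dyadicIco hb a hh, lintegral_dyadicIco hb a hh, ← hp, ← h0] at h1
      have h2 := hchild r hr
      rw [← h0] at h2
      have h3 : volume (dyadicIco a h r) ≠ 0 := by
        rw [measure_congr (dyadicIco_ae_eq a hh r), volume_cube]
        exact pow_ne_zero _ (ENNReal.ofReal_pos.mpr (dyadicParam_snd_pos a hh r)).ne'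
      simp only [ENNReal.ofReal_zero, zero_mul, nonpos_iff_eq_zero, mul_eq_zero, h3, or_false,
        ENNReal.ofReal_eq_zero] at h1
      linarith
    simp [hempty]
  · rw [mul_comm 2 (meanDev b p p), ENNReal.ofReal_mul hpos.le, mul_assoc,
      ENNReal.mul_le_mul_iff_right (ENNReal.ofReal_pos.mpr hpos).ne' ENNReal.ofReal_ne_top] at hle
    simpa using hle

theorem volume_cube_le_two_mul_stopSet {b : (Fin n → ℝ) → ℝ} (hb : LocallyIntegrable b volume)
    (a : Fin n → ℝ) {h : ℝ} (hh : 0 < h) {q : ℕ × (Fin n → ℕ)}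
    (hq : stopCube a h b q.1 q.2 = q) :
    volume (Cube (dyadicParam a h q).1 (dyadicParam a h q).2) ≤
      2 * volume (stopSet a h b (dyadicParam a h q)) := by
  have hfin := volume_cube_ne_top (dyadicParam a h q).1 (dyadicParam a h q).2
  rw [← measure_congr (dyadicIco_ae_eq a hh q)] at hfin ⊢
  have h1 := (measure_mono (μ := volume) (dyadicIco_subset_union_stopSet a h b hq)).trans
    (measure_union_le _ _)
  refine (ENNReal.add_le_add_iff_left hfin).mp ?_
  calc volume (dyadicIco a h q) + volume (dyadicIco a h q)
      = 2 * volume (dyadicIco a h q) := (two_mul _).symm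
    _ ≤ 2 * (_ + _) := by gcongr
    _ = _ := mul_add _ _ _
    _ ≤ _ := by gcongr; exact two_mul_volume_stopChildren_le hb a hh q

open Classical in
theorem abs_cubeAvg_stopCube_sub_le {b : (Fin n → ℝ) → ℝ} (hb : LocallyIntegrable b volume)
    (a : Fin n → ℝ) {h : ℝ} (hh : 0 < h) (x : Fin n → ℝ) (k : ℕ) :
    |cubeAvg (dyadicParam a h (stopCube a h b k (dyadicPos a h k x))).1
          (dyadicParam a h (stopCube a h b k (dyadicPos a h k x))).2 b -
        cubeAvg (dyadicParam a h (0, dyadicPos a h 0 x)).1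
          (dyadicParam a h (0, dyadicPos a h 0 x)).2 b| +
      2 ^ (n + 1) * meanDev b (dyadicParam a h (stopCube a h b k (dyadicPos a h k x)))
        (dyadicParam a h (stopCube a h b k (dyadicPos a h k x))) ≤
      2 ^ (n + 1) * ∑ j ∈ Finset.range (k + 1) with
          stopCube a h b j (dyadicPos a h j x) = (j, dyadicPos a h j x),
        meanDev b (dyadicParam a h (j, dyadicPos a h j x))
          (dyadicParam a h (j, dyadicPos a h j x)) := by
  induction k with
  | zero => simp [stopCube, Finset.sum_filter]
  | succ k ih =>
    rw [Finset.sum_filter, Finset.sum_range_succ, ← Finset.sum_filter]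
    generalize hq : stopCube a h b k (dyadicPos a h k x) = q at ih
    have hq' := hq
    rw [← dyadicPos_succ_div_two] at hq'
    by_cases hlt : 2 * meanDev b (dyadicParam a h q) (dyadicParam a h q) <
      meanDev b (dyadicParam a h (k + 1, dyadicPos a h (k + 1) x)) (dyadicParam a h q)
    · have hs := stopCube_succ_of_lt hq' hlt
      rw [if_pos hs, hs]
      have h1 := abs_cubeAvg_sub_le hb (r := dyadicParam a h q)
        (dyadicParam_snd_pos a hh (k + 1, dyadicPos a h (k + 1) x))
      have h2 := meanDev_succ_le hb a hh k (dyadicPos a h (k + 1) x) (dyadicParam a h q)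
      have h3 := meanDev_stopCube_le a h b k (dyadicPos a h k x)
      rw [hq] at h3
      rw [dyadicPos_succ_div_two] at h2
      have h4 := mul_le_mul_of_nonneg_left h3 (by positivity : (0 : ℝ) ≤ 2 ^ n)
      have h5 := abs_sub_le
        (cubeAvg (dyadicParam a h (k + 1, dyadicPos a h (k + 1) x)).1
          (dyadicParam a h (k + 1, dyadicPos a h (k + 1) x)).2 b)
        (cubeAvg (dyadicParam a h q).1 (dyadicParam a h q).2 b)
        (cubeAvg (dyadicParam a h (0, dyadicPos a h 0 x)).1
          (dyadicParam a h (0, dyadicPos a h 0 x)).2 b)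
      rw [pow_succ] at ih ⊢
      rw [mul_add]
      linarith
    · rw [stopCube_succ_of_not_lt hq' hlt, mul_add]
      refine ih.trans (le_add_of_nonneg_right (mul_nonneg (by positivity) ?_))
      split_ifs
      · exact meanDev_nonneg _ _ _
      · exact le_rfl

open Classical in
theorem abs_cubeAvg_dyadicPos_sub_le {b : (Fin n → ℝ) → ℝ} (hb : LocallyIntegrable b volume)
    (a : Fin n → ℝ) {h : ℝ} (hh : 0 < h) (x : Fin n → ℝ) (k : ℕ) :
    |cubeAvg (dyadicParam a h (k, dyadicPos a h k x)).1
          (dyadicParam a h (k, dyadicPos a h k x)).2 b -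
        cubeAvg (dyadicParam a h (0, dyadicPos a h 0 x)).1
          (dyadicParam a h (0, dyadicPos a h 0 x)).2 b| ≤
      2 ^ (n + 1) * ∑ j ∈ Finset.range (k + 1) with
          stopCube a h b j (dyadicPos a h j x) = (j, dyadicPos a h j x),
        meanDev b (dyadicParam a h (j, dyadicPos a h j x))
          (dyadicParam a h (j, dyadicPos a h j x)) := by
  refine le_trans ?_ (abs_cubeAvg_stopCube_sub_le hb a hh x k)
  have h3 := meanDev_stopCube_le a h b k (dyadicPos a h k x)
  generalize stopCube a h b k (dyadicPos a h k x) = q at h3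
  have h1 := abs_cubeAvg_sub_le hb (r := dyadicParam a h q)
    (dyadicParam_snd_pos a hh (k, dyadicPos a h k x))
  have h5 := abs_sub_le
    (cubeAvg (dyadicParam a h (k, dyadicPos a h k x)).1
      (dyadicParam a h (k, dyadicPos a h k x)).2 b)
    (cubeAvg (dyadicParam a h q).1 (dyadicParam a h q).2 b)
    (cubeAvg (dyadicParam a h (0, dyadicPos a h 0 x)).1
      (dyadicParam a h (0, dyadicPos a h 0 x)).2 b)
  have h6 : 2 * meanDev b (dyadicParam a h q) (dyadicParam a h q) ≤
      2 ^ (n + 1) * meanDev b (dyadicParam a h q) (dyadicParam a h q) := by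
    refine mul_le_mul_of_nonneg_right ?_ (meanDev_nonneg _ _ _)
    rw [pow_succ]
    linarith [one_le_pow₀ (one_le_two (α := ℝ)) (n := n)]
  linarith

theorem ae_tendsto_cubeAvg_dyadicPos {b : (Fin n → ℝ) → ℝ} (hb : LocallyIntegrable b volume)
    (a : Fin n → ℝ) {h : ℝ} (hh : 0 < h) :
    ∀ᵐ x, (∀ i, a i ≤ x i) → Filter.Tendsto
      (fun k => cubeAvg (dyadicParam a h (k, dyadicPos a h k x)).1
        (dyadicParam a h (k, dyadicPos a h k x)).2 b) Filter.atTop (nhds (b x)) := by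
  filter_upwards [IsUnifLocDoublingMeasure.ae_tendsto_average volume hb 1] with x hx hax
  have hball : ∀ k, Cube (dyadicParam a h (k, dyadicPos a h k x)).1
      (dyadicParam a h (k, dyadicPos a h k x)).2 = Metric.closedBall _ _ :=
    fun k => cube_eq_closedBall _ (dyadicParam_snd_pos a hh _).le
  simp only [cubeAvg, hball]
  refine hx _ _ ?_ (Filter.Eventually.of_forall fun k => ?_)
  · refine tendsto_nhdsWithin_iff.mpr ⟨?_, Filter.Eventually.of_forall fun k =>
      half_pos (dyadicParam_snd_pos a hh _)⟩
    have h1 := (tendsto_pow_atTop_nhds_zero_of_lt_one (r := (1 / 2 : ℝ)) (by norm_num)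
      (by norm_num)).const_mul (h / 2)
    rw [mul_zero] at h1
    refine h1.congr fun k => ?_
    simp only [dyadicParam, one_div, inv_pow]
    field_simp
  · rw [one_mul, ← hball]
    exact dyadicIco_subset a hh _ ⟨hax, rfl⟩

theorem dyadicPos_lt {a : Fin n → ℝ} {h : ℝ} (hh : 0 < h) {x : Fin n → ℝ}
    (hx : x ∈ dyadicIco a h (0, 0)) (k : ℕ) (i : Fin n) : dyadicPos a h k x i < 2 ^ k := by
  rw [dyadicIco_eq_pi a hh] at hx
  have h1 := hx i (mem_univ i)
  simp only [dyadicParam, Pi.zero_apply, Nat.cast_zero, zero_mul, add_zero, pow_zero, div_one,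
    mem_Ico] at h1
  have hd : 0 < h / 2 ^ k := by positivity
  have h0 : 0 ≤ (x i - a i) / (h / 2 ^ k) := div_nonneg (by linarith) hd.le
  rw [dyadicPos, Nat.floor_lt h0, div_lt_iff₀ hd]
  push_cast
  field_simp
  linarith

end

/-- for every cube `Q` and `b ∈ L¹_loc` there is a `1/2`-sparse family
`𝒮 ⊆ 𝒟(Q)` such that a.e. on `Q`,
`|b - b_Q| ≤ c_n ∑_{P ∈ 𝒮} (⨍_P |b - b_P|) χ_P`. -/
theorem stmt13 (n : ℕ) :
    ∃ c : ℝ, 0 < c ∧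
      ∀ (a₀ : Fin n → ℝ) (h₀ : ℝ), 0 < h₀ →
      ∀ b : (Fin n → ℝ) → ℝ, LocallyIntegrable b volume →
        ∃ (S : Set ((Fin n → ℝ) × ℝ)) (E : ((Fin n → ℝ) × ℝ) → Set (Fin n → ℝ)),
          S ⊆ dyadicOf a₀ h₀ ∧
          (∀ p ∈ S, MeasurableSet (E p) ∧ E p ⊆ Cube p.1 p.2 ∧
            volume (Cube p.1 p.2) ≤ 2 * volume (E p)) ∧
          (S.Pairwise fun p r => Disjoint (E p) (E r)) ∧
          ∀ᵐ x ∂volume.restrict (Cube a₀ h₀),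
            ENNReal.ofReal |b x - cubeAvg a₀ h₀ b| ≤
              ENNReal.ofReal c *
                ∑' p : S, (Cube p.1.1 p.1.2).indicator
                  (fun _ => ENNReal.ofReal
                    (⨍ y in Cube p.1.1 p.1.2, |b y - cubeAvg p.1.1 p.1.2 b|)) x := by
  classical
  refine ⟨2 ^ (n + 1), by positivity, fun a h hh b hb => ?_⟩
  set S : Set ((Fin n → ℝ) × ℝ) :=
    dyadicParam a h '' {q | stopCube a h b q.1 q.2 = q ∧ ∀ i, q.2 i < 2 ^ q.1}
  refine ⟨S, stopSet a h b, ?_, ?_, fun p _ r _ hpr => disjoint_stopSet a h b hpr, ?_⟩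
  · rintro _ ⟨q, ⟨-, hq⟩, rfl⟩
    exact ⟨q.1, q.2, hq, rfl, rfl⟩
  · rintro _ ⟨q, ⟨hq, -⟩, rfl⟩
    exact ⟨measurableSet_stopSet a h b _, stopSet_subset a hh b _,
      volume_cube_le_two_mul_stopSet hb a hh hq⟩
  have hparam : dyadicParam a h (0, 0) = (a, h) := by simp [dyadicParam]
  have hae := dyadicIco_ae_eq a hh (0, 0)
  rw [hparam] at hae
  rw [← Measure.restrict_congr_set hae, ae_restrict_iff' (measurableSet_dyadicIco a hh _)]
  filter_upwards [ae_tendsto_cubeAvg_dyadicPos hb a hh] with x hx hxQ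
  have h0 : dyadicPos a h 0 x = 0 := hxQ.2
  have hlim := ENNReal.tendsto_ofReal ((hx hxQ.1).sub_const (cubeAvg a h b)).abs
  refine le_of_tendsto hlim (Filter.Eventually.of_forall fun k => ?_)
  have hk := abs_cubeAvg_dyadicPos_sub_le hb a hh x k
  rw [h0, hparam] at hk
  refine (ENNReal.ofReal_le_ofReal hk).trans ?_
  rw [ENNReal.ofReal_mul (by positivity)]
  gcongr
  rw [ENNReal.ofReal_sum_of_nonneg fun _ _ => meanDev_nonneg _ _ _,
    tsum_subtype S fun p => (Cube p.1 p.2).indicator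
      (fun _ => ENNReal.ofReal (⨍ y in Cube p.1 p.2, |b y - cubeAvg p.1 p.2 b|)) x]
  have hinj : Function.Injective fun j => dyadicParam a h (j, dyadicPos a h j x) := by
    intro j l hjl
    have h1 : h / 2 ^ j = h / 2 ^ l := congrArg Prod.snd hjl
    refine pow_right_injective₀ (by norm_num : (0 : ℝ) < 2) (by norm_num) ?_
    field_simp at h1
    exact h1.symm
  refine le_trans (le_of_eq ?_) (ENNReal.sum_le_tsum (Finset.image
    (fun j => dyadicParam a h (j, dyadicPos a h j x)) (Finset.filter (fun j =>
      stopCube a h b j (dyadicPos a h j x) = (j, dyadicPos a h j x)) (Finset.range (k + 1)))))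
  rw [Finset.sum_image hinj.injOn]
  refine Finset.sum_congr rfl fun j hj => ?_
  rw [Set.indicator_of_mem, Set.indicator_of_mem]
  · rfl
  · exact dyadicIco_subset a hh _ ⟨hxQ.1, rfl⟩
  · exact ⟨_, ⟨(Finset.mem_filter.mp hj).2, dyadicPos_lt hh hxQ j⟩, rfl⟩
end
end
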